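/- arXiv:2009.10336 — 4 statements merged into one kernel-verified Lean document; each statement's English description precedes it below -/
import Mathlib

section
/- Let A be a unital C*-algebra and let T : A → A be a bounded linear map that is triple derivable at orthogonal pairs. Then there exist a continuous *-derivation D : A → A, a self-adjoint central element ξ ∈ A, and a skew-adjoint element η ∈ A such that T(a) = D(a) + ξ·a + (1/2)(η·a + a·η) for all a ∈ A. -/
variable {A : Type*} [NormedRing A] [StarRing A] [CStarRing A]
  [NormedAlgebra ℂ A] [StarModule ℂ A] [CompleteSpace A]

/-- The triple product `{x,y,z} = (1/2)(x y* z + z y* x)` on a C*-algebra. -/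
noncomputable def tp (x y z : A) : A := (2⁻¹ : ℂ) • (x * star y * z + z * star y * x)

/-- Orthogonality: `a ⊥ b` iff `a b* = 0` and `b* a = 0`. -/
def Orthog (a b : A) : Prop := a * star b = 0 ∧ star b * a = 0

/-- A map is triple derivable at orthogonal pairs. -/
def TripleDerivableAtOrthPairs (T : A → A) : Prop :=
  ∀ a b c : A, Orthog a b →
    tp (T a) b c + tp a (T b) c + tp a b (T c) = 0

section JordanDerivation

variable {R : Type*} [NormedRing R]

section NormedAlgebra

variable [NormedAlgebra ℂ R]

lemma eq_zero_of_eq_neg_self {a : R} (h : a = -a) : a = 0 := by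
  have h2 : (2 : ℂ) • a = 0 := by
    rw [two_smul]
    nth_rewrite 1 [h]
    exact neg_add_cancel a
  exact (smul_eq_zero.1 h2).resolve_left two_ne_zero

variable {d : R →ₗ[ℂ] R}

lemma LinearMap.map_mul_add_mul_of_map_sq (hd : ∀ x, d (x * x) = d x * x + x * d x) (x y : R) :
    d (x * y + y * x) = d x * y + x * d y + (d y * x + y * d x) := by
  have h := hd (x + y)
  have e : (x + y) * (x + y) = x * x + y * y + (x * y + y * x) := by noncomm_ring
  rw [e, map_add, map_add d (x * x), hd, hd, map_add d x y] at h
  rw [← sub_eq_zero] at h ⊢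
  rw [← h]
  noncomm_ring

lemma LinearMap.map_mul_mul_of_map_sq (hd : ∀ x, d (x * x) = d x * x + x * d x) (x y : R) :
    d (x * y * x) = d x * y * x + x * d y * x + x * y * d x := by
  have h := map_mul_add_mul_of_map_sq hd x (x * y + y * x)
  have h1 := map_mul_add_mul_of_map_sq hd (x * x) y
  have e : x * (x * y + y * x) + (x * y + y * x) * x =
      (x * x * y + y * (x * x)) + (2 : ℂ) • (x * y * x) := by
    rw [two_smul]; noncomm_ring
  rw [e, map_add, map_smul, h1, map_mul_add_mul_of_map_sq hd x y, hd] at h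
  have h2 : (2 : ℂ) • d (x * y * x) =
      (2 : ℂ) • (d x * y * x + x * d y * x + x * y * d x) := by
    rw [two_smul ℂ (d x * y * x + x * d y * x + x * y * d x), ← sub_eq_zero]
    rw [← sub_eq_zero] at h
    rw [← h]
    noncomm_ring
  exact smul_right_injective R (two_ne_zero (α := ℂ)) h2

lemma LinearMap.map_mul_mul_add_of_map_sq (hd : ∀ x, d (x * x) = d x * x + x * d x) (x y z : R) :
    d (x * y * z + z * y * x) = d x * y * z + x * d y * z + x * y * d z +
      (d z * y * x + z * d y * x + z * y * d x) := by
  have h := map_mul_mul_of_map_sq hd (x + z) y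
  have e : (x + z) * y * (x + z) = x * y * x + z * y * z + (x * y * z + z * y * x) := by
    noncomm_ring
  rw [e, map_add, map_add d (x * y * x), map_mul_mul_of_map_sq hd, map_mul_mul_of_map_sq hd,
    map_add d x z] at h
  rw [← sub_eq_zero] at h ⊢
  rw [← h]
  noncomm_ring

/-- The failure of `d` to satisfy the Leibniz rule at `x` and `y`. -/
noncomputable def leibnizDefect (d : R →ₗ[ℂ] R) (x y : R) : R := d (x * y) - d x * y - x * d y

lemma leibnizDefect_add_left (x u y : R) :
    leibnizDefect d (x + u) y = leibnizDefect d x y + leibnizDefect d u y := by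
  simp only [leibnizDefect, add_mul, map_add]; abel

lemma leibnizDefect_add_right (x y v : R) :
    leibnizDefect d x (y + v) = leibnizDefect d x y + leibnizDefect d x v := by
  simp only [leibnizDefect, mul_add, map_add]; abel

lemma leibnizDefect_swap (hd : ∀ x, d (x * x) = d x * x + x * d x) (x y : R) :
    leibnizDefect d y x = -leibnizDefect d x y := by
  have h := LinearMap.map_mul_add_mul_of_map_sq hd x y
  rw [map_add] at h
  rw [← sub_eq_zero] at h ⊢
  simp only [leibnizDefect]
  rw [← h]
  noncomm_ring

end NormedAlgebra

variable [StarRing R] [CStarRing R]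

lemma CStarRing.eq_zero_of_forall_mul_mul_self {a : R} (h : ∀ z, a * z * a = 0) : a = 0 := by
  have h1 : (star a * a) * (star a * a) = 0 := by
    have := h (star a)
    rw [mul_assoc (star a), ← mul_assoc a, this, mul_zero]
  have h2 : star (star a * a) * (star a * a) = 0 := by simpa using h1
  exact CStarRing.star_mul_self_eq_zero_iff _ |>.1 (CStarRing.star_mul_self_eq_zero_iff _ |>.1 h2)

variable [NormedAlgebra ℂ R]

lemma CStarRing.mul_mul_eq_zero_of_add_eq_zero {a b : R}
    (h : ∀ z, a * z * b + b * z * a = 0) (z : R) : a * z * b = 0 := by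
  refine eq_zero_of_forall_mul_mul_self fun w => eq_zero_of_eq_neg_self ?_
  have h' : ∀ z, a * z * b = -(b * z * a) := fun z => eq_neg_of_add_eq_zero_left (h z)
  calc a * z * b * w * (a * z * b) = -((a * (z * b * w) * b) * (z * a)) := by
        rw [h' z]; nth_rewrite 1 [← h' z]; noncomm_ring
    _ = b * z * (b * w * a) * (z * a) := by rw [h' (z * b * w)]; noncomm_ring
    _ = -((b * z * a) * w * (b * z * a)) := by
        rw [← neg_neg (b * w * a), ← h' w]; noncomm_ring
    _ = -(a * z * b * w * (a * z * b)) := by rw [h' z]; noncomm_ring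

variable {d : R →ₗ[ℂ] R}

lemma leibnizDefect_mul_commutator_self (hd : ∀ x, d (x * x) = d x * x + x * d x) (x y z : R) :
    leibnizDefect d x y * z * (x * y - y * x) = 0 := by
  refine CStarRing.mul_mul_eq_zero_of_add_eq_zero (fun z => ?_) z
  have h1 := LinearMap.map_mul_mul_of_map_sq hd x (y * z * y)
  have h2 := LinearMap.map_mul_mul_of_map_sq hd y (x * z * x)
  rw [LinearMap.map_mul_mul_of_map_sq hd y z] at h1
  rw [LinearMap.map_mul_mul_of_map_sq hd x z] at h2
  have h3 := LinearMap.map_mul_mul_add_of_map_sq hd (x * y) z (y * x)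
  have e : x * y * z * (y * x) + y * x * z * (x * y) =
      x * (y * z * y) * x + y * (x * z * x) * y := by noncomm_ring
  rw [e, map_add, h1, h2] at h3
  have hxy : d (x * y) = leibnizDefect d x y + (d x * y + x * d y) := by
    simp only [leibnizDefect]; abel
  have hyx : d (y * x) = -leibnizDefect d x y + (d y * x + y * d x) := by
    rw [← leibnizDefect_swap hd]; simp only [leibnizDefect]; abel
  rw [hxy, hyx, ← sub_eq_zero] at h3
  rw [← h3]
  noncomm_ring

lemma leibnizDefect_mul_commutator (hd : ∀ x, d (x * x) = d x * x + x * d x) (x y z u v : R) :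
    leibnizDefect d x y * z * (u * v - v * u) = 0 := by
  have key : ∀ x y z u : R, leibnizDefect d x y * z * (u * y - y * u) = 0 := by
    intro x y z u
    refine CStarRing.eq_zero_of_forall_mul_mul_self fun w => ?_
    have h : leibnizDefect d u y * z * (x * y - y * x) =
        -(leibnizDefect d x y * z * (u * y - y * u)) := by
      have h1 := leibnizDefect_mul_commutator_self hd (x + u) y z
      have h2 := leibnizDefect_mul_commutator_self hd x y z
      have h3 := leibnizDefect_mul_commutator_self hd u y z
      rw [leibnizDefect_add_left] at h1
      rw [eq_neg_iff_add_eq_zero]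
      calc _ = (leibnizDefect d x y + leibnizDefect d u y) * z * ((x + u) * y - y * (x + u)) -
            leibnizDefect d x y * z * (x * y - y * x) -
            leibnizDefect d u y * z * (u * y - y * u) := by noncomm_ring
        _ = 0 := by rw [h1, h2, h3, sub_zero, sub_zero]
    calc _ = -(leibnizDefect d x y * (z * (u * y - y * u) * w * leibnizDefect d u y * z)
          * (x * y - y * x)) := by
          nth_rewrite 2 [← neg_neg (leibnizDefect d x y * z * (u * y - y * u))]
          rw [← h]; noncomm_ring
      _ = 0 := by rw [leibnizDefect_mul_commutator_self hd, neg_zero]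
  refine CStarRing.eq_zero_of_forall_mul_mul_self fun w => ?_
  have h : leibnizDefect d x v * z * (u * y - y * u) =
      -(leibnizDefect d x y * z * (u * v - v * u)) := by
    have h1 := key x (y + v) z u
    have h2 := key x y z u
    have h3 := key x v z u
    rw [leibnizDefect_add_right] at h1
    rw [eq_neg_iff_add_eq_zero]
    calc _ = (leibnizDefect d x y + leibnizDefect d x v) * z * (u * (y + v) - (y + v) * u) -
          leibnizDefect d x y * z * (u * y - y * u) -
          leibnizDefect d x v * z * (u * v - v * u) := by noncomm_ring
      _ = 0 := by rw [h1, h2, h3, sub_zero, sub_zero]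
  calc _ = -(leibnizDefect d x y * (z * (u * v - v * u) * w * leibnizDefect d x v * z)
        * (u * y - y * u)) := by
        nth_rewrite 2 [← neg_neg (leibnizDefect d x y * z * (u * v - v * u))]
        rw [← h]; noncomm_ring
    _ = 0 := by rw [key, neg_zero]

/-- A Jordan derivation of a C⋆-algebra is a derivation. -/
theorem LinearMap.map_mul_of_map_sq (hd : ∀ x, d (x * x) = d x * x + x * d x) (x y : R) :
    d (x * y) = d x * y + x * d y := by
  set δ := leibnizDefect d x y with hδ
  have hcomm : ∀ v, δ * v = v * δ := fun v => by
    refine sub_eq_zero.1 (CStarRing.eq_zero_of_forall_mul_mul_self fun z => ?_)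
    calc _ = δ * (v * z) * (δ * v - v * δ) - v * (δ * z * (δ * v - v * δ)) := by noncomm_ring
      _ = 0 := by
        rw [leibnizDefect_mul_commutator hd, leibnizDefect_mul_commutator hd]; simp
  have hmul : ∀ u v, δ * (u * v - v * u) = 0 := fun u v => by
    simpa using leibnizDefect_mul_commutator hd x y 1 u v
  set k := x * y - y * x with hk
  have h2δ : δ + δ = d k - (d x * y - y * d x) - (x * d y - d y * x) := by
    have h := leibnizDefect_swap hd x y
    have : δ + δ = leibnizDefect d x y - leibnizDefect d y x := by rw [h]; abel
    rw [this, hk, map_sub]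
    simp only [leibnizDefect]
    abel
  have hδδ : δ * δ + δ * δ = δ * d k := by
    rw [← mul_add, h2δ, mul_sub, mul_sub, hmul, hmul, sub_zero, sub_zero]
  have h0 : δ * (δ * d k) = 0 := by
    have h := map_mul_add_mul_of_map_sq hd δ k
    have hkδ : k * δ = 0 := by rw [← hcomm, hmul]
    rw [hmul, hkδ, add_zero, map_zero] at h
    refine eq_zero_of_eq_neg_self (eq_neg_of_add_eq_zero_left ?_)
    calc _ = δ * (δ * d k + d k * δ) := by rw [← hcomm (d k)]; noncomm_ring
      _ = δ * (d δ * k + δ * d k + (d k * δ + k * d δ)) - δ * d δ * k - (δ * k) * d δ := by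
        noncomm_ring
      _ = 0 := by rw [← h, hcomm (d δ), mul_assoc, hmul]; simp
  have h3 : δ * δ * δ = 0 := by
    refine eq_zero_of_eq_neg_self (eq_neg_of_add_eq_zero_left ?_)
    rw [← h0, ← hδδ, mul_add, mul_assoc]
  have h1 : δ = 0 := by
    have hsq : δ * δ = 0 := CStarRing.eq_zero_of_forall_mul_mul_self fun z => by
      calc _ = δ * (δ * z) * (δ * δ) := by simp only [mul_assoc]
        _ = δ * (z * δ) * (δ * δ) := by rw [hcomm z]
        _ = δ * z * (δ * δ * δ) := by simp only [mul_assoc]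
        _ = 0 := by rw [h3, mul_zero]
    exact CStarRing.eq_zero_of_forall_mul_mul_self fun z => by
      rw [hcomm z, mul_assoc, hsq, mul_zero]
  rw [hδ, leibnizDefect, sub_sub, sub_eq_zero] at h1
  exact h1

end JordanDerivation

section OrthogonalForm

variable {K E : Type*} [TopologicalSpace K] [NormedAddCommGroup E] [NormedSpace ℝ E]

/-- The part of the nonnegative function `y` between heights `i - 1` and `i`. -/
def layer (y : C(K, ℝ)) (i : ℕ) : C(K, ℝ) where
  toFun t := max 0 (min 1 (y t + 1 - i))

lemma layer_apply (y : C(K, ℝ)) (i : ℕ) (t : K) :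
    layer y i t = max 0 (min 1 (y t + 1 - i)) := rfl

lemma layer_zero {y : C(K, ℝ)} (hy : 0 ≤ y) : layer y 0 = 1 := by
  ext t
  have : 0 ≤ y t := hy t
  simp [layer_apply, this]

lemma layer_mul_one_sub_layer (y : C(K, ℝ)) {i j : ℕ} (hij : i < j) :
    layer y j * (1 - layer y i) = 0 := by
  ext t
  have h : (i : ℝ) + 1 ≤ j := by exact_mod_cast hij
  simp only [ContinuousMap.mul_apply, ContinuousMap.sub_apply, ContinuousMap.one_apply,
    ContinuousMap.zero_apply, layer_apply]
  rcases le_total (y t + 1 - j) 0 with h1 | h1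
  · rw [max_eq_left ((min_le_right _ _).trans h1), zero_mul]
  · rw [min_eq_left (a := (1 : ℝ)) (b := y t + 1 - i) (by linarith)]
    simp

lemma layer_succ_le (y : C(K, ℝ)) (i : ℕ) (t : K) : layer y (i + 1) t ≤ layer y i t := by
  simp only [layer_apply]
  push_cast
  gcongr
  linarith

lemma sum_layer_succ_apply (y : C(K, ℝ)) (M : ℕ) (t : K) :
    ∑ i ∈ Finset.range M, layer y (i + 1) t = max 0 (min (M : ℝ) (y t)) := by
  induction M with
  | zero => simp
  | succ M ih =>
    have hM : (0 : ℝ) ≤ M := M.cast_nonneg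
    rw [Finset.sum_range_succ, ih, layer_apply]
    push_cast
    grind

variable [CompactSpace K]

lemma sum_layer_succ {y : C(K, ℝ)} (hy : 0 ≤ y) {M : ℕ} (hM : ‖y‖ ≤ M) :
    ∑ i ∈ Finset.range M, layer y (i + 1) = y := by
  ext t
  have h0 : 0 ≤ y t := hy t
  have h1 : y t ≤ M := (le_abs_self _).trans ((y.norm_coe_le_norm t).trans hM)
  rw [ContinuousMap.sum_apply, sum_layer_succ_apply, min_eq_right h1, max_eq_right h0]

lemma norm_sum_layer_sub_le (y : C(K, ℝ)) (k : ℕ) {M : ℕ} {S : Finset ℕ}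
    (hS : S ⊆ Finset.range M) :
    ‖∑ i ∈ S, (layer y (i + k) - layer y (i + k + 1))‖ ≤ 1 := by
  rw [ContinuousMap.norm_le _ zero_le_one]
  intro t
  have hnn : ∀ i, 0 ≤ layer y (i + k) t - layer y (i + k + 1) t := fun i =>
    sub_nonneg.2 (layer_succ_le y _ t)
  simp only [ContinuousMap.sum_apply, ContinuousMap.sub_apply]
  rw [Real.norm_of_nonneg (Finset.sum_nonneg fun i _ => hnn i)]
  refine (Finset.sum_le_sum_of_subset_of_nonneg hS fun i _ _ => hnn i).trans ?_
  have htel : ∑ i ∈ Finset.range M, (layer y (i + k) t - layer y (i + k + 1) t) =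
      layer y (0 + k) t - layer y (M + k) t := by
    rw [← Finset.sum_range_sub' (fun i => layer y (i + k) t) M]
    exact Finset.sum_congr rfl fun i _ => by rw [Nat.add_right_comm]
  rw [htel]
  have h1 : layer y (0 + k) t ≤ 1 := max_le zero_le_one (min_le_left _ _)
  have h2 : 0 ≤ layer y (M + k) t := le_max_left _ _
  linarith

lemma norm_sum_le_of_layers {V : C(K, ℝ) →ₗ[ℝ] C(K, ℝ) →ₗ[ℝ] E} {C : ℝ} (hC0 : 0 ≤ C)
    (hC : ∀ f g, ‖V f g‖ ≤ C * ‖f‖ * ‖g‖) {p q : ℕ → C(K, ℝ)} (M : ℕ)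
    (hp : ∀ S ⊆ Finset.range M, ‖∑ i ∈ S, p i‖ ≤ 1)
    (hq : ∀ S ⊆ Finset.range M, ‖∑ i ∈ S, q i‖ ≤ 1)
    (hV : ∀ i j, i ≠ j → i % 3 = j % 3 → V (p i) (q j) = 0) :
    ‖∑ i ∈ Finset.range M, V (p i) (q i)‖ ≤ 3 * C := by
  have hmaps : ∀ i ∈ Finset.range M, i % 3 ∈ Finset.range 3 := fun i _ =>
    Finset.mem_range.2 (Nat.mod_lt _ (by norm_num))
  rw [← Finset.sum_fiberwise_of_maps_to hmaps]
  have hr : ∀ r ∈ Finset.range 3,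
      ‖∑ i ∈ Finset.range M with i % 3 = r, V (p i) (q i)‖ ≤ C := by
    intro r _
    set S := (Finset.range M).filter (fun i => i % 3 = r) with hS
    have hSM : S ⊆ Finset.range M := Finset.filter_subset _ _
    have e : ∑ i ∈ S, V (p i) (q i) = V (∑ i ∈ S, p i) (∑ j ∈ S, q j) := by
      simp only [map_sum, LinearMap.sum_apply]
      rw [Finset.sum_comm]
      refine Finset.sum_congr rfl fun i hi => ?_
      rw [Finset.sum_eq_single i]
      · intro j hj hji
        refine hV i j hji.symm ?_
        rw [(Finset.mem_filter.1 hi).2, (Finset.mem_filter.1 hj).2]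
      · exact fun h => absurd hi h
    rw [e]
    calc _ ≤ C * ‖∑ i ∈ S, p i‖ * ‖∑ j ∈ S, q j‖ := hC _ _
      _ ≤ C * 1 * 1 := by gcongr; exacts [hp S hSM, hq S hSM]
      _ = C := by ring
  calc _ ≤ ∑ _r ∈ Finset.range 3, C := norm_sum_le_of_le _ hr
    _ = 3 * C := by simp

variable {V : C(K, ℝ) →ₗ[ℝ] C(K, ℝ) →ₗ[ℝ] E} {C : ℝ}

lemma norm_apply_one_sub_le_of_nonneg (hC0 : 0 ≤ C) (hC : ∀ f g, ‖V f g‖ ≤ C * ‖f‖ * ‖g‖)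
    (hV : ∀ f g, f * g = 0 → V f g = 0) {y : C(K, ℝ)} (hy : 0 ≤ y) :
    ‖V y 1 - V 1 y‖ ≤ 6 * C := by
  obtain ⟨M, hM⟩ := exists_nat_ge ‖y‖
  set w := layer y with hw
  have hl : ∀ i j, i < j → V (w j) (w i) = V (w j) 1 := fun i j hij => by
    have := hV _ _ (layer_mul_one_sub_layer y hij)
    rw [map_sub, sub_eq_zero] at this
    exact this.symm
  have hr : ∀ i j, i < j → V (w i) (w j) = V 1 (w j) := fun i j hij => by
    have := hV (1 - w i) (w j) (by rw [mul_comm]; exact layer_mul_one_sub_layer y hij)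
    rw [map_sub, LinearMap.sub_apply, sub_eq_zero] at this
    exact this.symm
  have hstep : ∀ i, V (w (i + 1)) 1 - V 1 (w (i + 1)) =
      V (w (i + 1) - w (i + 1 + 1)) (w i - w (i + 1)) -
        V (w i - w (i + 1)) (w (i + 1) - w (i + 1 + 1)) := fun i => by
    simp only [map_sub, LinearMap.sub_apply]
    rw [hl i (i + 1) (by omega), hl i (i + 1 + 1) (by omega), hl (i + 1) (i + 1 + 1) (by omega),
      hr i (i + 1) (by omega), hr i (i + 1 + 1) (by omega), hr (i + 1) (i + 1 + 1) (by omega)]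
    abel
  have hfar : ∀ i j, i + 1 < j → V (w i - w (i + 1)) (w j - w (j + 1)) = 0 ∧
      V (w j - w (j + 1)) (w i - w (i + 1)) = 0 := fun i j hij => by
    simp only [map_sub, LinearMap.sub_apply]
    rw [hl i j (by omega), hl i (j + 1) (by omega), hl (i + 1) j (by omega),
      hl (i + 1) (j + 1) (by omega), hr i j (by omega), hr i (j + 1) (by omega),
      hr (i + 1) j (by omega), hr (i + 1) (j + 1) (by omega)]
    constructor <;> abel
  have hsum : V y 1 - V 1 y = ∑ i ∈ Finset.range M,
        V (w (i + 1) - w (i + 1 + 1)) (w i - w (i + 1)) -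
      ∑ i ∈ Finset.range M, V (w i - w (i + 1)) (w (i + 1) - w (i + 1 + 1)) := by
    rw [← Finset.sum_sub_distrib, ← Finset.sum_congr rfl fun i _ => hstep i,
      Finset.sum_sub_distrib, ← map_sum (V 1), sum_layer_succ hy hM]
    congr 1
    nth_rewrite 1 [← sum_layer_succ hy hM]
    rw [map_sum, LinearMap.sum_apply]
  rw [hsum]
  have h1 := norm_sum_le_of_layers hC0 hC (p := fun i => w (i + 1) - w (i + 1 + 1))
    (q := fun i => w i - w (i + 1)) M (fun S hS => norm_sum_layer_sub_le y 1 hS)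
    (fun S hS => norm_sum_layer_sub_le y 0 hS) (fun i j hij hmod => by
      rcases lt_or_gt_of_ne hij with h | h
      · exact (hfar (i + 1) j (by omega)).1
      · exact (hfar j (i + 1) (by omega)).2)
  have h2 := norm_sum_le_of_layers hC0 hC (p := fun i => w i - w (i + 1))
    (q := fun i => w (i + 1) - w (i + 1 + 1)) M (fun S hS => norm_sum_layer_sub_le y 0 hS)
    (fun S hS => norm_sum_layer_sub_le y 1 hS) (fun i j hij hmod => by
      rcases lt_or_gt_of_ne hij with h | h
      · exact (hfar i (j + 1) (by omega)).1
      · exact (hfar (j + 1) i (by omega)).2)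
  calc _ ≤ _ := norm_sub_le _ _
    _ ≤ 3 * C + 3 * C := add_le_add h1 h2
    _ = 6 * C := by ring

/-- A bounded bilinear map on `C(K, ℝ)` which vanishes on pairs with zero product is symmetric
at `1`. -/
theorem apply_one_eq_of_mul_eq_zero (hC0 : 0 ≤ C) (hC : ∀ f g, ‖V f g‖ ≤ C * ‖f‖ * ‖g‖)
    (hV : ∀ f g, f * g = 0 → V f g = 0) (x : C(K, ℝ)) : V x 1 = V 1 x := by
  rw [← sub_eq_zero, ← norm_eq_zero]
  by_contra hne
  have hpos : 0 < ‖V x 1 - V 1 x‖ := lt_of_le_of_ne (norm_nonneg _) (Ne.symm hne)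
  obtain ⟨n, hn⟩ := exists_nat_gt (6 * C / ‖V x 1 - V 1 x‖)
  rw [div_lt_iff₀ hpos] at hn
  have hy : 0 ≤ (n : ℝ) • (x + ‖x‖ • (1 : C(K, ℝ))) := by
    intro t
    have h := neg_le_of_abs_le (x.norm_coe_le_norm t)
    have h' : 0 ≤ x t + ‖x‖ := by linarith
    simpa [mul_add] using mul_nonneg n.cast_nonneg h'
  have h := norm_apply_one_sub_le_of_nonneg hC0 hC hV hy
  simp only [map_smul, map_add, LinearMap.smul_apply, LinearMap.add_apply] at h
  rw [← smul_sub, add_sub_add_right_eq_sub, norm_smul, Real.norm_natCast] at h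
  linarith

end OrthogonalForm

section CStarAlgebra

variable {B : Type*} [CStarAlgebra B]

/-- A bounded bilinear map which vanishes on pairs of self-adjoint elements with zero product is
symmetric at `1`, and so are its translates, on the commutative algebra generated by a
self-adjoint element. -/
lemma IsSelfAdjoint.bilin_mul_eq {x : B} (hx : IsSelfAdjoint x) {E : Type*}
    [NormedAddCommGroup E] [NormedSpace ℝ E] {V : B →ₗ[ℝ] B →ₗ[ℝ] E} {C : ℝ} (hC0 : 0 ≤ C)
    (hC : ∀ a b, ‖V a b‖ ≤ C * ‖a‖ * ‖b‖)
    (hV : ∀ a b, IsSelfAdjoint a → IsSelfAdjoint b → a * b = 0 → b * a = 0 → V a b = 0) :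
    V x 1 = V 1 x ∧ V (x * x) 1 = V x x := by
  let φ := cfcHom (R := ℝ) hx
  have hφ : ∀ f, ‖φ f‖ = ‖f‖ := fun f => norm_cfcHom x f
  have hid : φ (ContinuousMap.restrict (spectrum ℝ x) (.id ℝ)) = x := cfcHom_id hx
  set X := ContinuousMap.restrict (spectrum ℝ x) (.id ℝ)
  have hsa : ∀ f, IsSelfAdjoint (φ f) := fun f => cfcHom_predicate hx f
  let L : C(spectrum ℝ x, ℝ) →ₗ[ℝ] B := φ.toAlgHom.toLinearMap
  have hW : ∀ f g, f * g = 0 → V (φ f) (φ g) = 0 := fun f g hfg =>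
    hV _ _ (hsa f) (hsa g) (by rw [← map_mul, hfg, map_zero])
      (by rw [← map_mul, mul_comm, hfg, map_zero])
  refine ⟨?_, ?_⟩
  · have := apply_one_eq_of_mul_eq_zero (V := V.compl₁₂ L L) hC0
      (fun f g => by
        rw [← hφ f, ← hφ g]
        exact hC (φ f) (φ g)) hW X
    change V (φ X) (φ 1) = V (φ 1) (φ X) at this
    rwa [hid, map_one] at this
  · have := apply_one_eq_of_mul_eq_zero (V := V.compl₁₂ (L ∘ₗ LinearMap.mulLeft ℝ X) L)
      (C := C * ‖X‖) (by positivity)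
      (fun f g => by
        calc ‖V (φ (X * f)) (φ g)‖ ≤ C * ‖X * f‖ * ‖g‖ := by
              simpa only [hφ] using hC (φ (X * f)) (φ g)
          _ ≤ C * (‖X‖ * ‖f‖) * ‖g‖ := by gcongr; exact norm_mul_le _ _
          _ = C * ‖X‖ * ‖f‖ * ‖g‖ := by ring)
      (fun f g hfg => hW (X * f) g (by rw [mul_assoc, hfg, mul_zero])) X
    change V (φ (X * X)) (φ 1) = V (φ (X * 1)) (φ X) at this
    rwa [mul_one, map_mul, hid, map_one] at this

lemma eq_of_eqOn_isSelfAdjoint {F : Type*} [AddCommGroup F] [Module ℂ F] {f g : B →ₗ[ℂ] F}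
    (h : ∀ x, IsSelfAdjoint x → f x = g x) (x : B) : f x = g x := by
  rw [← realPart_add_I_smul_imaginaryPart x]
  simp only [map_add, map_smul]
  rw [h _ (realPart x).2, h _ (imaginaryPart x).2]

/-- Symmetry at `1` of the real-bilinear map `(a, b) ↦ T a * b + a * (T b⋆)⋆` and of its
opposite. -/
lemma orthogonal_derivable_identities (T : B →L[ℂ] B)
    (h₁ : ∀ a b, a * star b = 0 → star b * a = 0 → T a * star b + a * star (T b) = 0)
    (h₂ : ∀ a b, a * star b = 0 → star b * a = 0 → star b * T a + star (T b) * a = 0)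
    {x : B} (hx : IsSelfAdjoint x) :
    (T x + x * star (T 1) = T 1 * x + star (T x) ∧
      T (x * x) + x * x * star (T 1) = T x * x + x * star (T x)) ∧
    T x + star (T 1) * x = x * T 1 + star (T x) := by
  let S : B →ₗ[ℝ] B :=
    { toFun b := star (T (star b))
      map_add' := by simp
      map_smul' := by simp }
  have hS : ∀ b, IsSelfAdjoint b → S b = star (T b) := fun b hb => by
    change star (T (star b)) = _
    rw [hb.star_eq]
  have hSn : ∀ b, ‖S b‖ ≤ ‖T‖ * ‖b‖ := fun b => by
    change ‖star (T (star b))‖ ≤ _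
    rw [norm_star, ← norm_star b]
    exact T.le_opNorm _
  let T' : B →ₗ[ℝ] B := (T : B →ₗ[ℂ] B).restrictScalars ℝ
  let M := LinearMap.mul ℝ B
  have hbound : ∀ a b : B, ‖T a * b‖ + ‖a * S b‖ ≤ 2 * ‖T‖ * ‖a‖ * ‖b‖ := fun a b => by
    have e1 : ‖T a * b‖ ≤ ‖T‖ * ‖a‖ * ‖b‖ := (norm_mul_le _ _).trans (by
      gcongr; exact T.le_opNorm a)
    have e2 : ‖a * S b‖ ≤ ‖a‖ * (‖T‖ * ‖b‖) := (norm_mul_le _ _).trans (by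
      gcongr; exact hSn b)
    linarith
  have hbound' : ∀ a b : B, ‖b * T a‖ + ‖S b * a‖ ≤ 2 * ‖T‖ * ‖a‖ * ‖b‖ := fun a b => by
    have e1 : ‖b * T a‖ ≤ ‖b‖ * (‖T‖ * ‖a‖) := (norm_mul_le _ _).trans (by
      gcongr; exact T.le_opNorm a)
    have e2 : ‖S b * a‖ ≤ ‖T‖ * ‖b‖ * ‖a‖ := (norm_mul_le _ _).trans (by
      gcongr; exact hSn b)
    linarith
  have hA := hx.bilin_mul_eq (V := M.compl₁₂ T' .id + M.compl₁₂ .id S) (C := 2 * ‖T‖)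
    (by positivity) (fun a b => (norm_add_le _ _).trans (hbound a b))
    (fun a b _ hb hab hba => by
      change T a * b + a * S b = 0
      have := h₁ a b (by rwa [hb.star_eq]) (by rwa [hb.star_eq])
      rwa [hb.star_eq, ← hS b hb] at this)
  have hB := hx.bilin_mul_eq (V := M.flip.compl₁₂ T' .id + M.flip.compl₁₂ .id S) (C := 2 * ‖T‖)
    (by positivity) (fun a b => (norm_add_le _ _).trans (hbound' a b))
    (fun a b _ hb hab hba => by
      change b * T a + S b * a = 0
      have := h₂ a b (by rwa [hb.star_eq]) (by rwa [hb.star_eq])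
      rwa [hb.star_eq, ← hS b hb] at this)
  change (T x * 1 + x * S 1 = T 1 * x + 1 * S x ∧
    T (x * x) * 1 + x * x * S 1 = T x * x + x * S x) at hA
  change (1 * T x + S 1 * x = x * T 1 + S x * 1 ∧ _) at hB
  rw [hS x hx, hS 1 (.one B), mul_one, mul_one, one_mul] at hA
  rw [hS x hx, hS 1 (.one B), mul_one, one_mul] at hB
  exact ⟨hA, hB.1⟩

/-- A bounded map satisfying the two binary orthogonality conditions is the sum of a
`*`-derivation, a central self-adjoint multiplier and a skew-adjoint Jordan multiplier. -/
theorem exists_derivation_of_orthogonal_derivable (T : B →L[ℂ] B)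
    (h₁ : ∀ a b, a * star b = 0 → star b * a = 0 → T a * star b + a * star (T b) = 0)
    (h₂ : ∀ a b, a * star b = 0 → star b * a = 0 → star b * T a + star (T b) * a = 0) :
    ∃ (D : B →L[ℂ] B) (ξ η : B),
      (∀ x y : B, D (x * y) = D x * y + x * D y) ∧
      (∀ x : B, D (star x) = star (D x)) ∧
      IsSelfAdjoint ξ ∧ (∀ x : B, ξ * x = x * ξ) ∧
      star η = -η ∧
      (∀ a : B, T a = D a + ξ * a + (2⁻¹ : ℂ) • (η * a + a * η)) := by
  obtain ⟨ξ, hξ⟩ : ∃ ξ : B, ξ = (2⁻¹ : ℂ) • (T 1 + star (T 1)) := ⟨_, rfl⟩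
  obtain ⟨η, hη⟩ : ∃ η : B, η = (2⁻¹ : ℂ) • (T 1 - star (T 1)) := ⟨_, rfl⟩
  have hT1 : T 1 = ξ + η := by rw [hξ, hη]; module
  have hT1' : star (T 1) = ξ - η := by rw [hξ, hη]; module
  have hξs : IsSelfAdjoint ξ := by
    rw [IsSelfAdjoint, hξ]
    simp [star_smul, add_comm]
  have hηs : star η = -η := by
    rw [hη, ← smul_neg]
    simp [star_smul]
  have key := fun x hx => orthogonal_derivable_identities T h₁ h₂ (x := x) hx
  rw [hT1', hT1] at key
  have hcomm : ∀ x, ξ * x = x * ξ := fun x => by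
    refine eq_of_eqOn_isSelfAdjoint (f := LinearMap.mulLeft ℂ ξ) (g := LinearMap.mulRight ℂ ξ)
      (fun x hx => ?_) x
    obtain ⟨⟨e1, -⟩, e2⟩ := key x hx
    change ξ * x = x * ξ
    refine smul_right_injective B (two_ne_zero (α := ℂ)) ?_
    change (2 : ℂ) • (ξ * x) = (2 : ℂ) • (x * ξ)
    rw [two_smul, two_smul, ← sub_eq_zero]
    rw [← sub_eq_zero] at e1 e2
    rw [← sub_zero (0 : B)]
    nth_rewrite 1 [← e2]
    rw [← e1]
    noncomm_ring
  let D : B →L[ℂ] B := T - ContinuousLinearMap.mul ℂ B ξ -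
    (2⁻¹ : ℂ) • (ContinuousLinearMap.mul ℂ B η + (ContinuousLinearMap.mul ℂ B).flip η)
  have hD : ∀ a, D a = T a - ξ * a - (2⁻¹ : ℂ) • (η * a + a * η) := fun a => rfl
  have hTD : ∀ a, T a = D a + ξ * a + (2⁻¹ : ℂ) • (η * a + a * η) := fun a => by
    rw [hD]; abel
  have hDs : ∀ x, IsSelfAdjoint x → star (D x) = D x := fun x hx => by
    have e : star (T x) = T x + x * (ξ - η) - (ξ + η) * x :=
      eq_sub_of_add_eq' (key x hx).1.1.symm
    rw [hD, star_sub, star_sub, star_smul, e, star_add, star_mul, star_mul, star_mul,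
      hx.star_eq, hξs.star_eq, hηs, hcomm x, mul_sub, add_mul, hcomm x]
    simp only [star_inv₀, star_ofNat, neg_mul, mul_neg]
    module
  have hDstar : ∀ x, D (star x) = star (D x) := fun x => by
    conv_lhs => rw [← realPart_add_I_smul_imaginaryPart x]
    conv_rhs => rw [← realPart_add_I_smul_imaginaryPart x]
    simp only [star_add, star_smul, map_add, map_smul, (realPart x).2.star_eq,
      (imaginaryPart x).2.star_eq, hDs _ (realPart x).2, hDs _ (imaginaryPart x).2]
  have hDsq : ∀ x, IsSelfAdjoint x → D (x * x) = D x * x + x * D x := fun x hx => by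
    have e := (key x hx).1.2
    have e' : star (T x) = D x + ξ * x - (2⁻¹ : ℂ) • (η * x + x * η) := by
      rw [hTD x, star_add, star_add, hDs x hx, star_smul, star_mul, star_add, star_mul, star_mul,
        hx.star_eq, hξs.star_eq, hηs, hcomm x]
      simp only [star_inv₀, star_ofNat, neg_mul, mul_neg]
      module
    rw [e', hTD x, hTD (x * x)] at e
    have c1 : x * x * ξ = ξ * x * x := by rw [← hcomm, mul_assoc]
    have c2 : x * (ξ * x) = ξ * x * x := by rw [← mul_assoc, hcomm]
    rw [mul_sub (x * x), c1, add_mul, add_mul, mul_sub x, mul_add x, c2, smul_mul_assoc,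
      mul_smul_comm, add_mul, mul_add x] at e
    simp only [← mul_assoc] at e ⊢
    rw [← sub_eq_zero] at e ⊢
    rw [← e]
    module
  have hDjordan : ∀ x, D (x * x) = D x * x + x * D x := fun x => by
    have hpol : ∀ a b, IsSelfAdjoint a → IsSelfAdjoint b →
        D (a * b + b * a) = D a * b + a * D b + (D b * a + b * D a) := fun a b ha hb => by
      have h := hDsq (a + b) (ha.add hb)
      have e : (a + b) * (a + b) = a * a + b * b + (a * b + b * a) := by noncomm_ring
      rw [e, map_add, map_add D (a * a), hDsq a ha, hDsq b hb, map_add D a b] at h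
      rw [← sub_eq_zero] at h ⊢
      rw [← h]
      noncomm_ring
    obtain ⟨a, b, ha, hb, rfl⟩ : ∃ a b : B, IsSelfAdjoint a ∧ IsSelfAdjoint b ∧
        x = a + Complex.I • b :=
      ⟨realPart x, imaginaryPart x, (realPart x).2, (imaginaryPart x).2,
        (realPart_add_I_smul_imaginaryPart x).symm⟩
    have e : (a + Complex.I • b) * (a + Complex.I • b) =
        a * a + Complex.I • (a * b + b * a) + (Complex.I * Complex.I) • (b * b) := by
      simp only [mul_add, add_mul, smul_mul_assoc, mul_smul_comm]
      module
    rw [e]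
    simp only [map_add D (a * a + _), map_add D (a * a), map_smul, hpol a b ha hb, hDsq a ha,
      hDsq b hb]
    simp only [map_add, map_smul, mul_add, add_mul, smul_mul_assoc, mul_smul_comm]
    module
  exact ⟨D, ξ, η, LinearMap.map_mul_of_map_sq (d := (D : B →ₗ[ℂ] B)) hDjordan, hDstar, hξs,
    hcomm, hηs, hTD⟩

end CStarAlgebra

/-- The defect of the Leibniz-type rule at an orthogonal pair is central with opposite one-sided
versions, which forces it to vanish. -/
lemma TripleDerivableAtOrthPairs.mul_star_add_eq_zero {T : A → A}
    (hT : TripleDerivableAtOrthPairs T) {a b : A} (hab : Orthog a b) :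
    T a * star b + a * star (T b) = 0 ∧ star b * T a + star (T b) * a = 0 := by
  obtain ⟨hab1, hab2⟩ := hab
  have h : ∀ c, (T a * star b + a * star (T b)) * c +
      c * (star b * T a + star (T b) * a) = 0 := fun c => by
    have h := hT a b c ⟨hab1, hab2⟩
    simp only [tp, ← smul_add] at h
    rw [smul_eq_zero, or_iff_right (by norm_num), hab1, mul_assoc (T c), hab2, zero_mul,
      mul_zero, add_zero, add_zero] at h
    rw [← h]
    noncomm_ring
  obtain ⟨p, hp⟩ : ∃ p, p = T a * star b + a * star (T b) := ⟨_, rfl⟩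
  obtain ⟨q, hq⟩ : ∃ q, q = star b * T a + star (T b) * a := ⟨_, rfl⟩
  rw [← hp, ← hq] at h ⊢
  have hqp : q = -p := by
    have := h 1
    rw [mul_one, one_mul] at this
    exact eq_neg_of_add_eq_zero_right this
  have hc : ∀ c, p * c = c * p := fun c => by
    have := h c
    rwa [hqp, mul_neg, ← sub_eq_add_neg, sub_eq_zero] at this
  have hpb : star b * p = 0 := by
    refine eq_zero_of_eq_neg_self ?_
    calc star b * p = star b * T a * star b + star b * a * star (T b) := by rw [hp]; noncomm_ring
      _ = star b * T a * star b + star (T b) * (a * star b) := by rw [hab1, hab2]; simp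
      _ = q * star b := by rw [hq]; noncomm_ring
      _ = -(star b * p) := by rw [hqp, neg_mul, hc]
  have hpa : p * a = 0 := by
    refine eq_zero_of_eq_neg_self ?_
    calc p * a = T a * (star b * a) + a * star (T b) * a := by rw [hp]; noncomm_ring
      _ = a * star b * T a + a * star (T b) * a := by rw [hab1, hab2]; simp
      _ = a * q := by rw [hq]; noncomm_ring
      _ = -(p * a) := by rw [hqp, mul_neg, hc]
  have hpp : p * p = 0 := by
    calc p * p = T a * (star b * p) + a * (star (T b) * p) := by
          nth_rewrite 1 [hp]; noncomm_ring
      _ = a * p * star (T b) := by rw [hpb, ← hc (star (T b))]; noncomm_ring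
      _ = 0 := by rw [← hc, hpa, zero_mul]
  have hp0 : p = 0 := CStarRing.eq_zero_of_forall_mul_mul_self fun z => by
    rw [hc, mul_assoc, hpp, mul_zero]
  exact ⟨hp0, by rw [hqp, hp0, neg_zero]⟩

/-- a bounded linear map on a unital C*-algebra which is triple derivable
at orthogonal pairs decomposes as `T = D + M_ξ + (1/2)(η·+·η)` with `D` a continuous
`*`-derivation, `ξ` a self-adjoint central element and `η` skew-adjoint. -/
theorem stmt0 (T : A →L[ℂ] A)
    (hT : TripleDerivableAtOrthPairs (T : A → A)) :
    ∃ (D : A →L[ℂ] A) (ξ η : A),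
      (∀ x y : A, D (x * y) = D x * y + x * D y) ∧
      (∀ x : A, D (star x) = star (D x)) ∧
      IsSelfAdjoint ξ ∧ (∀ x : A, ξ * x = x * ξ) ∧
      star η = -η ∧
      (∀ a : A, T a = D a + ξ * a + (2⁻¹ : ℂ) • (η * a + a * η)) := by
  let _ : CStarAlgebra A := {}
  exact exists_derivation_of_orthogonal_derivable T
    (fun _ _ h h' => (hT.mul_star_add_eq_zero ⟨h, h'⟩).1)
    (fun _ _ h h' => (hT.mul_star_add_eq_zero ⟨h, h'⟩).2)
end

section
/- Let A be a unital C*-algebra and let T : A → A be a bounded linear map. The following are equivalent: (a) T is triple derivable at zero, i.e. {T(a),b,c} + {a,T(b),c} + {a,b,T(c)} = 0 for all a,b,c ∈ A with {a,b,c} = 0; (b) T is triple derivable at orthogonal pairs; (c) there exist a continuous *-derivation D : A → A, a self-adjoint central element ξ ∈ A and a skew-adjoint element η ∈ A with T(a) = D(a) + ξ·a + (1/2)(η·a + a·η) for all a ∈ A; (d) there exist a triple derivation δ : A → A and a self-adjoint central element z ∈ A such that T(a) = δ(a) + z·a for all a ∈ A. -/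
variable {A : Type*} [NormedRing A] [StarRing A] [CStarRing A]
  [NormedAlgebra ℂ A] [StarModule ℂ A] [CompleteSpace A]

/-- A map is triple derivable at zero. -/
def TripleDerivableAtZero (T : A → A) : Prop :=
  ∀ a b c : A, tp a b c = 0 →
    tp (T a) b c + tp a (T b) c + tp a b (T c) = 0

/-- A triple derivation. -/
def IsTripleDerivation (δ : A → A) : Prop :=
  ∀ a b c : A, δ (tp a b c) = tp (δ a) b c + tp a (δ b) c + tp a b (δ c)

lemma integral_abs_sub {x M : ℝ} (hx : |x| ≤ M) :
    ∫ t in (-M)..M, |x - t| = x ^ 2 + M ^ 2 := by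
  obtain ⟨h1, h2⟩ := abs_le.mp hx
  have hc : Continuous fun t : ℝ => |x - t| := by fun_prop
  rw [← intervalIntegral.integral_add_adjacent_intervals
    (hc.intervalIntegrable (-M) x) (hc.intervalIntegrable x M)]
  have e1 : ∫ t in (-M)..x, |x - t| = ∫ t in (-M)..x, (x - t) := by
    refine intervalIntegral.integral_congr fun t ht => ?_
    rw [Set.uIcc_of_le h1] at ht
    exact abs_of_nonneg (sub_nonneg.2 ht.2)
  have e2 : ∫ t in x..M, |x - t| = ∫ t in x..M, (t - x) := by
    refine intervalIntegral.integral_congr fun t ht => ?_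
    rw [Set.uIcc_of_le h2] at ht
    simpa using abs_of_nonpos (sub_nonpos.2 ht.1)
  rw [e1, e2, intervalIntegral.integral_sub (by simp) (by simp),
    intervalIntegral.integral_sub (by simp) (by simp)]
  simp only [intervalIntegral.integral_const, integral_id, smul_eq_mul]
  ring

lemma integral_mul_abs_sub {x M : ℝ} (hx : |x| ≤ M) :
    ∫ t in (-M)..M, t * |x - t| = x ^ 3 / 3 - x * M ^ 2 := by
  obtain ⟨h1, h2⟩ := abs_le.mp hx
  have hc : Continuous fun t : ℝ => t * |x - t| := by fun_prop
  rw [← intervalIntegral.integral_add_adjacent_intervals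
    (hc.intervalIntegrable (-M) x) (hc.intervalIntegrable x M)]
  have e1 : ∫ t in (-M)..x, t * |x - t| = ∫ t in (-M)..x, (x * t - t ^ 2) := by
    refine intervalIntegral.integral_congr fun t ht => ?_
    rw [Set.uIcc_of_le h1] at ht
    simp only [abs_of_nonneg (sub_nonneg.2 ht.2)]
    ring
  have e2 : ∫ t in x..M, t * |x - t| = ∫ t in x..M, (t ^ 2 - x * t) := by
    refine intervalIntegral.integral_congr fun t ht => ?_
    rw [Set.uIcc_of_le h2] at ht
    simp only [abs_of_nonpos (sub_nonpos.2 ht.1)]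
    ring
  have i1 (u v : ℝ) : IntervalIntegrable (fun t : ℝ => x * t) MeasureTheory.volume u v :=
    Continuous.intervalIntegrable (by fun_prop) _ _
  have i2 (u v : ℝ) : IntervalIntegrable (fun t : ℝ => t ^ 2) MeasureTheory.volume u v :=
    Continuous.intervalIntegrable (by fun_prop) _ _
  rw [e1, e2, intervalIntegral.integral_sub (i1 _ _) (i2 _ _),
    intervalIntegral.integral_sub (i2 _ _) (i1 _ _), intervalIntegral.integral_const_mul,
    intervalIntegral.integral_const_mul]
  simp only [integral_id, integral_pow]
  norm_num
  ring

section
open MeasureTheory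

variable {B : Type*} [CStarAlgebra B]

lemma cfc_intervalIntegral {a : B} (ha : IsSelfAdjoint a) {f : ℝ → ℝ → ℝ}
    (hf : Continuous (Function.uncurry f)) {u v : ℝ} (huv : u ≤ v) :
    IntervalIntegrable (fun t => cfc (f t) a) volume u v ∧
      cfc (fun x => ∫ t in u..v, f t x) a = ∫ t in u..v, cfc (f t) a := by
  obtain ⟨C, hC⟩ := (isCompact_Icc (a := u) (b := v)).prod
    (ContinuousFunctionalCalculus.isCompact_spectrum (R := ℝ) a) |>.exists_bound_of_continuousOn
    hf.continuousOn
  have hb : ∀ᵐ t ∂(volume.restrict (Set.Ioc u v)), ∀ z ∈ spectrum ℝ a, ‖f t z‖ ≤ C :=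
    ae_restrict_of_forall_mem measurableSet_Ioc fun t ht z hz =>
      hC (t, z) ⟨Set.Ioc_subset_Icc_self ht, hz⟩
  have hC' : HasFiniteIntegral (fun _ : ℝ => C) (volume.restrict (Set.Ioc u v)) :=
    (integrable_const C).hasFiniteIntegral
  constructor
  · rw [intervalIntegrable_iff_integrableOn_Ioc_of_le huv]
    exact integrableOn_cfc measurableSet_Ioc f (fun _ => C) a hf.continuousOn hb hC'
  · simp only [intervalIntegral.integral_of_le huv]
    exact cfc_setIntegral measurableSet_Ioc f (fun _ => C) a hf.continuousOn hb hC'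

lemma map_cfc_abs_sub_mul {φ : B →L[ℂ] B →L[ℂ] B}
    (hφ : ∀ x y, x * y = 0 → y * x = 0 → φ x y = 0) {a f k : B} (ha : IsSelfAdjoint a)
    (hf : Commute a f) (hk : Commute a k) (t : ℝ) :
    φ (cfc (fun x => |x - t|) a * f) ((a - algebraMap ℝ B t) * k) =
      φ ((a - algebraMap ℝ B t) * f) (cfc (fun x => |x - t|) a * k) := by
  have hu : a - algebraMap ℝ B t = cfc (fun x : ℝ => x - t) a := by
    rw [cfc_sub (fun x : ℝ => x) (fun _ => t) a, cfc_id' ℝ a, cfc_const t a]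
  set P := cfc (fun x : ℝ => |x - t|) a with hP
  rw [hu]
  set u := cfc (fun x : ℝ => x - t) a with hu'
  have hPf : P * f = f * P := (ha.commute_cfc hf _).eq
  have hPk : P * k = k * P := (ha.commute_cfc hk _).eq
  have huf : u * f = f * u := (ha.commute_cfc hf _).eq
  have huk : u * k = k * u := (ha.commute_cfc hk _).eq
  have hPu : P * u = u * P := (cfc_commute_cfc _ _ a).eq
  have hsq : P * P = u * u := by
    rw [hP, hu', ← cfc_mul .., ← cfc_mul ..]
    simp only [abs_mul_abs_self]
  have key : ∀ {p q : B}, p * q = 0 → q * p = 0 → p * f = f * p → p * k = k * p →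
      q * f = f * q → q * k = k * q → φ (p * f) (q * k) = 0 := by
    intro p q h1 h2 h3 h4 h5 h6
    apply hφ
    · rw [h3, mul_assoc, ← mul_assoc p, h1]; simp
    · rw [h6, mul_assoc, ← mul_assoc q, h2]; simp
  have hpm : (P + u) * (P - u) = 0 := by
    rw [add_mul, mul_sub, mul_sub, hPu, hsq]; abel
  have hmp : (P - u) * (P + u) = 0 := by
    rw [sub_mul, mul_add, mul_add, hPu, hsq]; abel
  have hpf : (P + u) * f = f * (P + u) := by rw [add_mul, mul_add, hPf, huf]
  have hpk : (P + u) * k = k * (P + u) := by rw [add_mul, mul_add, hPk, huk]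
  have hmf : (P - u) * f = f * (P - u) := by rw [sub_mul, mul_sub, hPf, huf]
  have hmk : (P - u) * k = k * (P - u) := by rw [sub_mul, mul_sub, hPk, huk]
  have h1 := key hpm hmp hpf hpk hmf hmk
  have h2 := key hmp hpm hmf hmk hpf hpk
  simp only [add_mul, sub_mul, map_add, map_sub, add_apply, sub_apply] at h1 h2
  have h3 : (2 : ℂ) • (φ (P * f) (u * k) - φ (u * f) (P * k)) = 0 := by
    linear_combination (norm := module) h2 - h1
  rw [smul_eq_zero] at h3
  exact sub_eq_zero.1 (h3.resolve_left two_ne_zero)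

lemma cubic_defect_eq_zero {φ : B →L[ℂ] B →L[ℂ] B}
    (hφ : ∀ x y, x * y = 0 → y * x = 0 → φ x y = 0) {a f k : B} (ha : IsSelfAdjoint a)
    (hf : Commute a f) (hk : Commute a k) :
    φ (a * (a * (a * f))) k - (3 : ℂ) • φ (a * (a * f)) (a * k)
      + (3 : ℂ) • φ (a * f) (a * (a * k)) - φ f (a * (a * (a * k))) = 0 := by
  set M := ‖a‖ * ‖(1 : B)‖ with hM
  have hM0 : -M ≤ M := by have : 0 ≤ M := by positivity
                          linarith
  have hspec : ∀ x ∈ spectrum ℝ a, |x| ≤ M := fun x hx => spectrum.norm_le_norm_mul_of_mem hx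
  obtain ⟨i1, e1⟩ := cfc_intervalIntegral ha (f := fun t x => |x - t|) (by fun_prop) hM0
  obtain ⟨i2, e2⟩ := cfc_intervalIntegral ha (f := fun t x => t * |x - t|) (by fun_prop) hM0
  have d1 : ∫ t in (-M)..M, cfc (fun x => |x - t|) a = a * a + algebraMap ℝ B (M ^ 2) := by
    rw [← e1, cfc_congr (g := fun x => x * x + M ^ 2)
      fun x hx => by simp only [integral_abs_sub (hspec x hx)]; ring]
    rw [cfc_add a (fun x : ℝ => x * x) (fun _ => M ^ 2), cfc_const _ a,
      cfc_mul (fun x : ℝ => x) (fun x => x) a, cfc_id' ℝ a]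
  have d2 : ∫ t in (-M)..M, cfc (fun x => t * |x - t|) a
      = (1 / 3 : ℝ) • (a * (a * a)) - (M ^ 2) • a := by
    rw [← e2, cfc_congr (g := fun x => (1 / 3 : ℝ) • (x * (x * x)) - (M ^ 2) • x)
      fun x hx => by simp only [integral_mul_abs_sub (hspec x hx), smul_eq_mul]; ring]
    rw [cfc_sub (fun x : ℝ => (1 / 3 : ℝ) • (x * (x * x))) (fun x => M ^ 2 • x) a,
      cfc_smul _ (fun x : ℝ => x * (x * x)) a, cfc_smul _ (fun x : ℝ => x) a,
      cfc_mul (fun x : ℝ => x) (fun x => x * x) a,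
      cfc_mul (fun x : ℝ => x) (fun x => x) a, cfc_id' ℝ a]
  let Φ : B →L[ℂ] B →L[ℂ] B := φ.bilinearComp ((ContinuousLinearMap.mul ℂ B).flip f)
    ((ContinuousLinearMap.mul ℂ B).flip k)
  have hΦ : ∀ x y, Φ x y = φ (x * f) (y * k) := fun x y => rfl
  have h1 : ∀ (t : ℝ) (x y : B), Φ (t • x) y = t • Φ x y := fun t x y =>
    (Φ.flip y).map_smul_of_tower t x
  have h2 : ∀ (t : ℝ) (x y : B), Φ x (t • y) = t • Φ x y := fun t x y =>
    (Φ x).map_smul_of_tower t y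
  have s2 : ∀ t : ℝ, cfc (fun x => t * |x - t|) a = t • cfc (fun x => |x - t|) a := fun t => by
    rw [← cfc_smul _ _ a]; rfl
  have pt : ∀ t : ℝ, Φ.flip a (cfc (fun x => |x - t|) a) - Φ.flip 1 (cfc (fun x => t * |x - t|) a)
      = Φ a (cfc (fun x => |x - t|) a) - Φ 1 (cfc (fun x => t * |x - t|) a) := fun t => by
    have := map_cfc_abs_sub_mul hφ ha hf hk t
    rw [← hΦ, ← hΦ] at this
    rw [s2]
    simp only [Algebra.algebraMap_eq_smul_one, map_sub, sub_apply, h1, h2] at this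
    simpa only [ContinuousLinearMap.flip_apply, h1, h2] using this
  have key := congrArg (fun F : ℝ → B => ∫ t in (-M)..M, F t) (funext pt)
  have ii : ∀ (L : B →L[ℂ] B) {F : ℝ → B}, IntervalIntegrable F volume (-M) M →
      IntervalIntegrable (fun t => L (F t)) volume (-M) M := fun L F hF =>
    ⟨L.integrable_comp hF.1, L.integrable_comp hF.2⟩
  rw [intervalIntegral.integral_sub (ii _ i1) (ii _ i2),
    intervalIntegral.integral_sub (ii _ i1) (ii _ i2),
    ContinuousLinearMap.intervalIntegral_comp_comm _ i1,
    ContinuousLinearMap.intervalIntegral_comp_comm _ i1,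
    ContinuousLinearMap.intervalIntegral_comp_comm _ i2,
    ContinuousLinearMap.intervalIntegral_comp_comm _ i2, d1, d2] at key
  simp only [Algebra.algebraMap_eq_smul_one, map_sub, map_add,
    ContinuousLinearMap.flip_apply, h1, h2] at key
  simp only [hΦ, one_mul, mul_assoc] at key
  have h3 : ∀ z : B, (1 / 3 : ℝ) • z = (1 / 3 : ℂ) • z := fun z => by
    rw [← Complex.coe_smul]; norm_num
  rw [h3, h3] at key
  linear_combination (norm := module) (-3 : ℂ) • key

/-- The bilinear map `(f, k) ↦ ψ (a f, k) - ψ (f, a k)`. -/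
noncomputable def shiftDefect (a : B) (ψ : B →L[ℂ] B →L[ℂ] B) : B →L[ℂ] B →L[ℂ] B :=
  ψ.comp (ContinuousLinearMap.mul ℂ B a) -
    ψ.bilinearComp (ContinuousLinearMap.id ℂ B) (ContinuousLinearMap.mul ℂ B a)

@[simp]
lemma shiftDefect_apply (a : B) (ψ : B →L[ℂ] B →L[ℂ] B) (f k : B) :
    shiftDefect a ψ f k = ψ (a * f) k - ψ f (a * k) := rfl

lemma hasDerivAt_exp_mul_exp_neg (a : B) (ψ : B →L[ℂ] B →L[ℂ] B) (f k : B) (z : ℂ) :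
    HasDerivAt (fun z : ℂ => ψ (NormedSpace.exp (z • a) * f) (NormedSpace.exp (z • -a) * k))
      (shiftDefect a ψ (NormedSpace.exp (z • a) * f) (NormedSpace.exp (z • -a) * k)) z := by
  have h1 := (hasDerivAt_exp_smul_const' (𝕂 := ℂ) a z).mul_const f
  have h2 := (hasDerivAt_exp_smul_const' (𝕂 := ℂ) (-a) z).mul_const k
  convert! ψ.hasDerivAt_of_bilinear (fun _ => h1) (fun _ => h2) using 1
  rw [shiftDefect_apply]
  simp only [mul_assoc, neg_mul, map_neg]
  abel

lemma eq_zero_of_bounded_affine {C : ℝ} {x y : B} (h : ∀ s : ℝ, ‖x + s • y‖ ≤ C) : y = 0 := by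
  by_contra hy
  have hy' : 0 < ‖y‖ := norm_pos_iff.2 hy
  have hC : 0 ≤ C := (norm_nonneg _).trans (h 0)
  have h1 := h ((C + ‖x‖ + 1) / ‖y‖)
  have h2 := norm_sub_le (x + ((C + ‖x‖ + 1) / ‖y‖) • y) x
  rw [add_sub_cancel_left, norm_smul, Real.norm_of_nonneg (by positivity),
    div_mul_cancel₀ _ hy'.ne'] at h2
  linarith

lemma norm_exp_I_smul_mul {a : B} (ha : IsSelfAdjoint a) (s : ℝ) (f : B) :
    ‖NormedSpace.exp ((s * Complex.I : ℂ) • a) * f‖ = ‖f‖ := by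
  have e : (s * Complex.I : ℂ) • a = Complex.I • (s • a) := by
    rw [mul_comm, mul_smul, Complex.coe_smul]
  rw [e]
  exact CStarRing.norm_coe_unitary_mul
    (selfAdjoint.expUnitary ⟨s • a, (IsSelfAdjoint.all s).smul ha⟩) f

lemma shiftDefect_eq_zero_of_sq {a : B} (ha : IsSelfAdjoint a) {ψ : B →L[ℂ] B →L[ℂ] B}
    (h : ∀ f k, Commute a f → Commute a k → shiftDefect a (shiftDefect a ψ) f k = 0)
    {f k : B} (hf : Commute a f) (hk : Commute a k) : shiftDefect a ψ f k = 0 := by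
  have hE : ∀ {g : B}, Commute a g → ∀ z : ℂ, Commute a (NormedSpace.exp (z • a) * g) :=
    fun hg z => (((Commute.refl a).smul_right z).exp_right).mul_right hg
  have hE' : ∀ {g : B}, Commute a g → ∀ z : ℂ, Commute a (NormedSpace.exp (z • -a) * g) :=
    fun hg z => ((((Commute.refl a).neg_right).smul_right z).exp_right).mul_right hg
  set c := shiftDefect a ψ f k with hc
  let G₁ : ℂ → B := fun z =>
    shiftDefect a ψ (NormedSpace.exp (z • a) * f) (NormedSpace.exp (z • -a) * k)
  have hG₁ : ∀ z, G₁ z = c := by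
    intro z
    have hd : ∀ z, HasDerivAt G₁ 0 z := fun z => by
      have := hasDerivAt_exp_mul_exp_neg a (shiftDefect a ψ) f k z
      rwa [h _ _ (hE hf z) (hE' hk z)] at this
    have := is_const_of_deriv_eq_zero (fun z => (hd z).differentiableAt)
      (fun z => (hd z).deriv) z 0
    rw [this]
    simp only [G₁, zero_smul, NormedSpace.exp_zero, one_mul, hc]
  let G : ℂ → B := fun z => ψ (NormedSpace.exp (z • a) * f) (NormedSpace.exp (z • -a) * k)
  have hG : ∀ z : ℂ, G z = ψ f k + z • c := by
    intro z
    have hd : ∀ z, HasDerivAt (fun z => G z - z • c) 0 z := fun z => by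
      have h1 : HasDerivAt G c z := by
        rw [← hG₁ z]; exact hasDerivAt_exp_mul_exp_neg a ψ f k z
      have h2 := h1.sub ((hasDerivAt_id z).smul_const c)
      rw [one_smul, sub_self] at h2
      exact h2
    have := is_const_of_deriv_eq_zero (fun z => (hd z).differentiableAt)
      (fun z => (hd z).deriv) z 0
    rw [eq_add_of_sub_eq this]
    simp only [G, zero_smul, NormedSpace.exp_zero, one_mul, sub_zero]
  have hb : ∀ s : ℝ, ‖ψ f k + s • (Complex.I • c)‖ ≤ ‖ψ‖ * ‖f‖ * ‖k‖ := fun s => by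
    have h1 := hG (s * Complex.I)
    rw [mul_smul, Complex.coe_smul] at h1
    rw [← h1]
    refine (ψ.le_opNorm₂ _ _).trans_eq ?_
    rw [norm_exp_I_smul_mul ha, norm_exp_I_smul_mul ha.neg]
  exact (smul_eq_zero.1 (eq_zero_of_bounded_affine hb)).resolve_left Complex.I_ne_zero

lemma map_mul_left_eq_map_mul_right {φ : B →L[ℂ] B →L[ℂ] B}
    (hφ : ∀ x y, x * y = 0 → y * x = 0 → φ x y = 0) {a f k : B} (ha : IsSelfAdjoint a)
    (hf : Commute a f) (hk : Commute a k) : φ (a * f) k = φ f (a * k) := by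
  have h3 : ∀ f k, Commute a f → Commute a k →
      shiftDefect a (shiftDefect a (shiftDefect a φ)) f k = 0 := fun f k hf hk => by
    rw [← cubic_defect_eq_zero hφ ha hf hk]
    simp only [shiftDefect_apply]
    module
  have h2 : ∀ f k, Commute a f → Commute a k → shiftDefect a (shiftDefect a φ) f k = 0 :=
    fun f k hf hk => shiftDefect_eq_zero_of_sq ha h3 hf hk
  exact sub_eq_zero.1 (shiftDefect_eq_zero_of_sq ha h2 hf hk)

end

section

variable {B : Type*} [CStarAlgebra B]

lemma eq_zero_of_add_self_eq_zero {x : B} (h : x + x = 0) : x = 0 := by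
  rw [← two_smul ℂ x, smul_eq_zero] at h
  exact h.resolve_left two_ne_zero

lemma eq_zero_of_forall_mul_mul_self {x : B} (h : ∀ y, x * y * x = 0) : x = 0 := by
  have h1 : star (star x * x) * (star x * x) = 0 := by
    rw [star_mul, star_star, mul_assoc, ← mul_assoc x, h, mul_zero]
  rwa [CStarRing.star_mul_self_eq_zero_iff, CStarRing.star_mul_self_eq_zero_iff] at h1

lemma mul_mul_eq_zero_of_add_eq_zero {w c : B} (h : ∀ x, w * x * c + c * x * w = 0) (x : B) :
    w * x * c = 0 := by
  have h1 : ∀ x y, w * x * c * y * c = 0 := fun x y => by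
    apply eq_zero_of_add_self_eq_zero
    linear_combination (norm := noncomm_ring) h (x * c * y) - c * x * h y + h x * y * c
  apply eq_zero_of_forall_mul_mul_self
  intro y
  have := h1 x (y * w * x)
  rw [← this]; noncomm_ring

variable {D : B →ₗ[ℂ] B}

lemma jordan_add (hD : ∀ x, D (x * x) = D x * x + x * D x) (x y : B) :
    D (x * y) + D (y * x) = D x * y + x * D y + D y * x + y * D x := by
  have h := hD (x + y)
  simp only [mul_add, add_mul, map_add, hD] at h
  linear_combination (norm := noncomm_ring) h

lemma jordan_mul_mul_self (hD : ∀ x, D (x * x) = D x * x + x * D x) (x y : B) :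
    D (x * y * x) = D x * y * x + x * D y * x + x * y * D x := by
  have h1 := jordan_add hD x (x * y + y * x)
  have h2 := jordan_add hD (x * x) y
  have h3 := jordan_add hD x y
  simp only [mul_add, add_mul, map_add, hD, mul_assoc] at h1 h2 h3 ⊢
  rw [← sub_eq_zero]
  apply eq_zero_of_add_self_eq_zero
  linear_combination (norm := noncomm_ring) h1 - h2 + x * h3 + h3 * x

lemma jordan_mul_mul_add (hD : ∀ x, D (x * x) = D x * x + x * D x) (x y z : B) :
    D (x * y * z) + D (z * y * x) = D x * y * z + x * D y * z + x * y * D z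
      + D z * y * x + z * D y * x + z * y * D x := by
  have h := jordan_mul_mul_self hD (x + z) y
  simp only [mul_add, add_mul, map_add, jordan_mul_mul_self hD] at h
  linear_combination (norm := noncomm_ring) h

lemma jordan_herstein (hD : ∀ x, D (x * x) = D x * x + x * D x) (a b x : B) :
    (D (a * b) - D a * b - a * D b) * x * (a * b - b * a)
      + (a * b - b * a) * x * (D (a * b) - D a * b - a * D b) = 0 := by
  have h1 := jordan_mul_mul_add hD (a * b) x (b * a)
  have h2 := jordan_mul_mul_self hD a (b * x * b)
  have h3 := jordan_mul_mul_self hD b (a * x * a)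
  have h4 := jordan_mul_mul_self hD b x
  have h5 := jordan_mul_mul_self hD a x
  have h6 := jordan_add hD a b
  simp only [mul_assoc] at h1 h2 h3 h4 h5 h6 ⊢
  linear_combination (norm := noncomm_ring) h1 - h2 - h3 - a * h4 * a - b * h5 * b
    + h6 * x * (a * b) + a * b * x * h6

lemma jordan_derivation (hD : ∀ x, D (x * x) = D x * x + x * D x) (a b : B) :
    D (a * b) = D a * b + a * D b := by
  have hwc : ∀ a b x, (D (a * b) - D a * b - a * D b) * x * (a * b - b * a) = 0 := fun a b x =>
    mul_mul_eq_zero_of_add_eq_zero (jordan_herstein hD a b) x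
  have hcw : ∀ a b x, (a * b - b * a) * x * (D (a * b) - D a * b - a * D b) = 0 := fun a b x => by
    have := jordan_herstein hD a b x
    rwa [hwc, zero_add] at this
  have hlin : ∀ a b c x, (D (a * b) - D a * b - a * D b) * x * (c * b - b * c) = 0 := by
    intro a b c x
    have e : ∀ x, (D (a * b) - D a * b - a * D b) * x * (c * b - b * c)
        = - ((D (c * b) - D c * b - c * D b) * x * (a * b - b * a)) := fun x => by
      have h := hwc (a + c) b x
      have h1 := hwc a b x
      have h2 := hwc c b x
      simp only [add_mul, mul_add, map_add] at h
      linear_combination (norm := noncomm_ring) h - h1 - h2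
    apply eq_zero_of_forall_mul_mul_self
    intro y
    nth_rewrite 2 [e]
    have := hcw c b y
    linear_combination (norm := noncomm_ring)
      -((D (a * b) - D a * b - a * D b) * x) * this * (x * (a * b - b * a))
  have hsw : ∀ a b, D (b * a) - D b * a - b * D a = -(D (a * b) - D a * b - a * D b) :=
    fun a b => by
    linear_combination (norm := noncomm_ring) jordan_add hD a b
  have hlin' : ∀ a b c x, (D (a * b) - D a * b - a * D b) * x * (a * c - c * a) = 0 := by
    intro a b c x
    have := hlin b a c x
    rw [hsw a b] at this
    linear_combination (norm := noncomm_ring) this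
  have hDc : D (a * b - b * a) = (D (a * b) - D a * b - a * D b)
      + (D (a * b) - D a * b - a * D b) + (D a * b - b * D a) + (a * D b - D b * a) := by
    rw [map_sub]
    linear_combination (norm := noncomm_ring) -hsw a b
  have hl := hlin a b (D a)
  have hl' := hlin' a b (D b)
  have hwc' := hwc a b
  have hcw' := hcw a b
  rw [← sub_eq_zero, ← sub_sub]
  generalize D (a * b) - D a * b - a * D b = w at *
  generalize a * b - b * a = c at *
  have hwD : ∀ z, w * z * D c = w * z * w + w * z * w := fun z => by
    rw [hDc]
    linear_combination (norm := noncomm_ring) hl z + hl' z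
  have hw0 : ∀ z y, w * z * w * y * w = 0 := fun z y => by
    have h := jordan_mul_mul_add hD w y c
    rw [hwc' y, hcw' y, map_zero, add_zero] at h
    apply eq_zero_of_add_self_eq_zero
    apply eq_zero_of_add_self_eq_zero
    have e1 := hwD z
    have e2 := hwD (z * w * y)
    have e3 := hwc' (z * D w * y)
    have e4 := hwc' (z * w * D y)
    have e5 := hwc' z
    linear_combination (norm := noncomm_ring) -(w * z) * h - e3 - e4 - e2 - e1 * y * w
      - e5 * D y * w - e5 * y * D w
  apply eq_zero_of_forall_mul_mul_self
  intro z
  apply eq_zero_of_forall_mul_mul_self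
  intro y
  linear_combination (norm := noncomm_ring) hw0 z y * (z * w)
end

section

variable {B : Type*} [CStarAlgebra B]

lemma orthogonal_identities {T : B → B}
    (hT : ∀ a b, a * star b = 0 → star b * a = 0 → ∀ c,
      (T a * star b + a * star (T b)) * c + c * (star b * T a + star (T b) * a) = 0)
    {a b : B} (h1 : a * star b = 0) (h2 : star b * a = 0) :
    T a * star b + a * star (T b) = 0 ∧ star b * T a + star (T b) * a = 0 := by
  have h1' : b * star a = 0 := by simpa using congrArg star h1
  have h2' : star a * b = 0 := by simpa using congrArg star h2
  have key := hT a b h1 h2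
  have e := key 1
  have ea := key a
  have eb := congrArg star (hT b a h1' h2' b)
  simp only [star_add, star_mul, star_star, star_zero, mul_one, one_mul] at e ea eb
  have hc : ∀ c, (T a * star b + a * star (T b)) * c = c * (T a * star b + a * star (T b)) :=
    fun c => by linear_combination (norm := noncomm_ring) key c - c * e
  have hxa : a * star (T b) * a = 0 := by
    apply eq_zero_of_add_self_eq_zero
    linear_combination (norm := noncomm_ring) ea - T a * h2 - h1 * T a
  have hxb : star b * T a * star b = 0 := by
    apply eq_zero_of_add_self_eq_zero
    linear_combination (norm := noncomm_ring) eb - star (T b) * h1 - h2 * star (T b)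
  have hx : T a * star b + a * star (T b) = 0 := by
    generalize hz : T a * star b + a * star (T b) = z at hc
    have hza : z * a = 0 := by
      rw [← hz]
      linear_combination (norm := noncomm_ring) T a * h2 + hxa
    have hbz : star b * z = 0 := by
      rw [← hz]
      linear_combination (norm := noncomm_ring) hxb + h2 * star (T b)
    have hzz : z * z = 0 := by
      nth_rewrite 2 [← hz]
      linear_combination (norm := noncomm_ring)
        hza * star (T b) + hc (T a * star b) + T a * hbz
    apply eq_zero_of_forall_mul_mul_self
    intro y
    rw [mul_assoc, ← hc y, ← mul_assoc, hzz, zero_mul]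
  refine ⟨hx, ?_⟩
  linear_combination (norm := noncomm_ring) e - hx

/-- The map `x ↦ (T x⋆)⋆`. -/
noncomputable def starConj (T : B →L[ℂ] B) : B →L[ℂ] B :=
  ((starL ℂ : B ≃L⋆[ℂ] B) : B →L⋆[ℂ] B).comp
    (T.comp ((starL ℂ : B ≃L⋆[ℂ] B) : B →L⋆[ℂ] B))

lemma starConj_apply (T : B →L[ℂ] B) (x : B) : starConj T x = star (T (star x)) := rfl

lemma selfAdjoint_induction {p : B → Prop}
    (h : ∀ a b, IsSelfAdjoint a → IsSelfAdjoint b → p (a + Complex.I • b)) (x : B) : p x := by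
  rw [← realPart_add_I_smul_imaginaryPart x]
  exact h _ _ (realPart x).2 (imaginaryPart x).2

lemma exists_decomposition_of_orthogonal {T : B →L[ℂ] B}
    (hT : ∀ a b, a * star b = 0 → star b * a = 0 → ∀ c,
      (T a * star b + a * star (T b)) * c + c * (star b * T a + star (T b) * a) = 0) :
    ∃ (D : B →L[ℂ] B) (ξ η : B),
      (∀ x y : B, D (x * y) = D x * y + x * D y) ∧
      (∀ x : B, D (star x) = star (D x)) ∧
      IsSelfAdjoint ξ ∧ (∀ x : B, ξ * x = x * ξ) ∧
      star η = -η ∧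
      (∀ a : B, T a = D a + ξ * a + (2⁻¹ : ℂ) • (η * a + a * η)) := by
  have hO : ∀ x y, x * y = 0 → y * x = 0 →
      T x * y + x * starConj T y = 0 ∧ y * T x + starConj T y * x = 0 := fun x y h1 h2 => by
    simpa [starConj_apply] using orthogonal_identities hT (a := x) (b := star y) (by simpa) (by simpa)
  let m := ContinuousLinearMap.mul ℂ B
  let φ₁ : B →L[ℂ] B →L[ℂ] B := m.comp T + (m.flip.comp (starConj T)).flip
  let φ₂ : B →L[ℂ] B →L[ℂ] B := m.flip.comp T + (m.comp (starConj T)).flip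
  have hφ₁ : ∀ x y, φ₁ x y = T x * y + x * starConj T y := fun _ _ => rfl
  have hφ₂ : ∀ x y, φ₂ x y = y * T x + starConj T y * x := fun _ _ => rfl
  have hS1 : starConj T 1 = star (T 1) := by rw [starConj_apply, star_one]
  have k1 : ∀ a, IsSelfAdjoint a → T a + a * star (T 1) = T 1 * a + starConj T a := fun a ha => by
    have := map_mul_left_eq_map_mul_right (φ := φ₁) (fun x y h h' => (hO x y h h').1) ha
      (Commute.one_right a) (Commute.one_right a)
    simpa [hφ₁, hS1] using this
  have k2 : ∀ a, IsSelfAdjoint a → T a + star (T 1) * a = a * T 1 + starConj T a := fun a ha => by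
    have := map_mul_left_eq_map_mul_right (φ := φ₂) (fun x y h h' => (hO x y h h').2) ha
      (Commute.one_right a) (Commute.one_right a)
    simpa [hφ₂, hS1] using this
  have k3 : ∀ a, IsSelfAdjoint a →
      T (a * a) + a * a * star (T 1) = T a * a + a * starConj T a := fun a ha => by
    have := map_mul_left_eq_map_mul_right (φ := φ₁) (fun x y h h' => (hO x y h h').1) ha
      (Commute.refl a) (Commute.one_right a)
    simpa [hφ₁, hS1] using this
  have k1' : ∀ x, T x + x * star (T 1) = T 1 * x + starConj T x := fun x => by
    induction x using selfAdjoint_induction with | h a b ha hb => ?_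
    simp only [map_add, map_smul, add_mul, mul_add, smul_mul_assoc, mul_smul_comm]
    linear_combination (norm := module) k1 a ha + Complex.I • k1 b hb
  have k2' : ∀ x, T x + star (T 1) * x = x * T 1 + starConj T x := fun x => by
    induction x using selfAdjoint_induction with | h a b ha hb => ?_
    simp only [map_add, map_smul, add_mul, mul_add, smul_mul_assoc, mul_smul_comm]
    linear_combination (norm := module) k2 a ha + Complex.I • k2 b hb
  obtain ⟨ξ, hξ⟩ : ∃ ξ, ξ = (2⁻¹ : ℂ) • (T 1 + star (T 1)) := ⟨_, rfl⟩
  obtain ⟨ζ, hζ⟩ : ∃ ζ, ζ = (4⁻¹ : ℂ) • (T 1 - star (T 1)) := ⟨_, rfl⟩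
  have hξs : star ξ = ξ := by
    rw [hξ, star_smul, star_add, star_star, add_comm (star _)]
    norm_num
  have hζs : star ζ = -ζ := by
    rw [hζ, star_smul, star_sub, star_star, ← smul_neg, neg_sub]
    norm_num
  have hh : T 1 = ξ + (ζ + ζ) := by
    rw [hξ, hζ]; module
  have hh' : star (T 1) = ξ - (ζ + ζ) := by
    rw [hξ, hζ]; module
  have hc : ∀ x, ξ * x = x * ξ := fun x => by
    have h1 := k1' x
    have h2 := k2' x
    rw [hh', hh] at h1 h2
    rw [← sub_eq_zero]
    apply eq_zero_of_add_self_eq_zero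
    linear_combination (norm := noncomm_ring) h2 - h1
  let D : B →L[ℂ] B := T - m ξ - (m ζ + m.flip ζ)
  have hDa : ∀ x, D x = T x - ξ * x - (ζ * x + x * ζ) := fun _ => rfl
  have hstar : ∀ x, D (star x) = star (D x) := fun x => by
    have h1 := k1' (star x)
    rw [starConj_apply, star_star, hh', hh] at h1
    simp only [hDa, star_sub, star_add, star_mul, hξs, hζs]
    linear_combination (norm := noncomm_ring) h1
  have hsq : ∀ a, IsSelfAdjoint a → D (a * a) = D a * a + a * D a := fun a ha => by
    have h1 := k1' a
    have h3 := k3 a ha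
    rw [hh', hh] at h1
    rw [hh'] at h3
    simp only [hDa]
    linear_combination (norm := noncomm_ring) h3 - a * h1
  have hsq' : ∀ x, D (x * x) = D x * x + x * D x := fun x => by
    induction x using selfAdjoint_induction with | h a b ha hb => ?_
    have h1 := hsq _ (ha.add hb)
    have h2 := hsq a ha
    have h3 := hsq b hb
    simp only [map_add, map_smul, add_mul, mul_add, smul_mul_assoc, mul_smul_comm, smul_smul,
      smul_add, Complex.I_mul_I] at h1 ⊢
    linear_combination (norm := module) Complex.I • h1 + (1 - Complex.I) • h2 - (1 + Complex.I) • h3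
  refine ⟨D, ξ, ζ + ζ, fun x y => jordan_derivation (D := (D : B →ₗ[ℂ] B)) hsq' x y, hstar, hξs, hc,
    ?_, fun x => ?_⟩
  · rw [star_add, hζs, neg_add]
  · rw [hDa, add_mul, mul_add]
    module

end

omit [CStarRing A] [StarModule ℂ A] [CompleteSpace A] in
lemma tp_eq_zero_of_orthog {a b : A} (h : Orthog a b) (c : A) : tp a b c = 0 := by
  simp [tp, h.1, mul_assoc, h.2]

lemma TripleDerivableAtOrthPairs.exists_decomposition {T : A →L[ℂ] A}
    (hT : TripleDerivableAtOrthPairs (T : A → A)) :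
    ∃ (D : A →L[ℂ] A) (ξ η : A),
      (∀ x y : A, D (x * y) = D x * y + x * D y) ∧
      (∀ x : A, D (star x) = star (D x)) ∧
      IsSelfAdjoint ξ ∧ (∀ x : A, ξ * x = x * ξ) ∧
      star η = -η ∧
      (∀ a : A, T a = D a + ξ * a + (2⁻¹ : ℂ) • (η * a + a * η)) := by
  let _ : CStarAlgebra A := {}
  refine exists_decomposition_of_orthogonal (B := A) fun a b h1 h2 c => ?_
  have h := hT a b c ⟨h1, h2⟩
  rw [tp_eq_zero_of_orthog ⟨h1, h2⟩, add_zero] at h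
  simp only [tp, ← smul_add, smul_eq_zero, inv_eq_zero, two_ne_zero, false_or] at h
  linear_combination (norm := noncomm_ring) h

omit [CStarRing A] [CompleteSpace A] in
lemma isTripleDerivation_add_jordan {D : A →ₗ[ℂ] A} {η : A}
    (hD : ∀ x y, D (x * y) = D x * y + x * D y) (hs : ∀ x, D (star x) = star (D x))
    (hη : star η = -η) :
    IsTripleDerivation fun a => D a + (2⁻¹ : ℂ) • (η * a + a * η) := by
  intro a b c
  simp only [tp, map_smul, map_add, hD, hs, star_add, star_smul, star_mul, hη, mul_add, add_mul,
    smul_mul_assoc, mul_smul_comm, smul_add, smul_smul, mul_assoc, neg_mul, mul_neg, RCLike.star_def,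
    map_inv₀, map_ofNat]
  module

omit [CStarRing A] [StarModule ℂ A] [CompleteSpace A] in
lemma tripleDerivableAtZero_of_isTripleDerivation {T : A → A} {δ : A →ₗ[ℂ] A} {z : A}
    (hδ : IsTripleDerivation (δ : A → A)) (hz : IsSelfAdjoint z) (hc : ∀ x, z * x = x * z)
    (hT : ∀ a, T a = δ a + z * a) : TripleDerivableAtZero T := by
  intro a b c h
  have h1 := hδ a b c
  rw [h, map_zero] at h1
  have h2 : (a * star b * c + c * star b * a) = 0 := by
    rwa [tp, smul_eq_zero_iff_right (inv_ne_zero two_ne_zero)] at h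
  have key : ∀ x y, x * (z * y) = z * (x * y) := fun x y => by
    rw [← mul_assoc, ← hc, mul_assoc]
  have h3 : z * (a * star b * c + c * star b * a) = 0 := by rw [h2, mul_zero]
  have hb : star (z * b) = z * star b := by rw [star_mul, hz.star_eq, hc]
  simp only [tp, hT, hb, star_add, mul_add, add_mul, mul_assoc, key] at h1 h3 ⊢
  linear_combination (norm := module) (3 / 2 : ℂ) • h3 - h1

/-- for a bounded linear map on a unital C*-algebra, being triple derivable
at zero, being triple derivable at orthogonal pairs, admitting the decomposition
`T = D + M_ξ + (1/2)(η·+·η)`, and being a triple derivation plus a central symmetric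
multiplier are all equivalent. -/
theorem stmt1 (T : A →L[ℂ] A) :
    List.TFAE
      [ TripleDerivableAtZero (T : A → A),
        TripleDerivableAtOrthPairs (T : A → A),
        (∃ (D : A →L[ℂ] A) (ξ η : A),
          (∀ x y : A, D (x * y) = D x * y + x * D y) ∧
          (∀ x : A, D (star x) = star (D x)) ∧
          IsSelfAdjoint ξ ∧ (∀ x : A, ξ * x = x * ξ) ∧
          star η = -η ∧
          (∀ a : A, T a = D a + ξ * a + (2⁻¹ : ℂ) • (η * a + a * η))),
        (∃ (δ : A →ₗ[ℂ] A) (z : A),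
          IsTripleDerivation (δ : A → A) ∧
          IsSelfAdjoint z ∧ (∀ x : A, z * x = x * z) ∧
          (∀ a : A, T a = δ a + z * a)) ] := by
  tfae_have 1 → 2 := fun h a b c hab => h a b c (tp_eq_zero_of_orthog hab c)
  tfae_have 2 → 3 := TripleDerivableAtOrthPairs.exists_decomposition
  tfae_have 3 → 4 := by
    rintro ⟨D, ξ, η, hD, hs, hξ, hc, hη, hT⟩
    refine ⟨(D + (2⁻¹ : ℂ) • (ContinuousLinearMap.mul ℂ A η
      + (ContinuousLinearMap.mul ℂ A).flip η) : A →L[ℂ] A), ξ,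
      isTripleDerivation_add_jordan (D := (D : A →ₗ[ℂ] A)) hD hs hη, hξ, hc, fun a => ?_⟩
    rw [hT a, add_right_comm]
    rfl
  tfae_have 4 → 1 := by
    rintro ⟨δ, z, hδ, hz, hc, hT⟩
    exact tripleDerivableAtZero_of_isTripleDerivation hδ hz hc hT
  tfae_finish
end

section
/- Let A be a unital C*-algebra and let T : A → A be an anti-symmetric bounded linear map that is triple derivable at orthogonal pairs. Then T(1) is skew-adjoint, T(x) = (1/2)(T(1)·x + x·T(1)) for all x ∈ A, and T is a triple derivation. -/
variable {A : Type*} [NormedRing A] [StarRing A] [CStarRing A]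
  [NormedAlgebra ℂ A] [StarModule ℂ A] [CompleteSpace A]

/-- The truncation of a real number to the unit interval. -/
noncomputable def unitClamp (x : ℝ) : ℝ := max 0 (min x 1)

lemma continuous_unitClamp : Continuous unitClamp := by
  unfold unitClamp; fun_prop

lemma unitClamp_of_nonpos {x : ℝ} (hx : x ≤ 0) : unitClamp x = 0 := by
  simp [unitClamp, hx]

lemma unitClamp_of_one_le {x : ℝ} (hx : 1 ≤ x) : unitClamp x = 1 := by
  simp [unitClamp, hx]

lemma unitClamp_nonneg (x : ℝ) : 0 ≤ unitClamp x := le_max_left _ _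

lemma unitClamp_le_one (x : ℝ) : unitClamp x ≤ 1 := by simp [unitClamp]

/-- A sum of steep unit ramps, one starting at each point `k + a`, stays close to the identity. -/
lemma abs_sub_sum_unitClamp_le {a t : ℝ} (ha : 0 ≤ a) (ha' : a ≤ 1) {N : ℕ} (ht : 0 ≤ t)
    (htN : t ≤ N) : |t - ∑ k ∈ Finset.range N, unitClamp (6 * (t - k - a))| ≤ 1 := by
  have key : ∀ M : ℕ,
      min t (M + 1) - min t 1 ≤ ∑ k ∈ Finset.range M, unitClamp (6 * (t - k - a)) ∧
      ∑ k ∈ Finset.range M, unitClamp (6 * (t - k - a)) ≤ min t (M - 1) - min t (-1) := by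
    intro M
    induction M with
    | zero => simp
    | succ M ih =>
      rw [Finset.sum_range_succ]
      have h₁ : min t (M + 1 + 1) - min t (M + 1) ≤ unitClamp (6 * (t - M - a)) := by
        unfold unitClamp; grind
      have h₂ : unitClamp (6 * (t - M - a)) ≤ min t M - min t (M - 1) := by
        unfold unitClamp; grind
      push_cast
      rw [add_sub_cancel_right]
      constructor <;> linarith [ih.1, ih.2]
  obtain ⟨h₁, h₂⟩ := key N
  rw [abs_le]
  constructor <;> grind

/-- A periodic bump function, vanishing near the integers and equal to one near the
half-integers. -/
noncomputable def periodicBump (t : ℝ) : ℝ := unitClamp (1 / 2 - Real.cos (t * (2 * Real.pi)))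

lemma continuous_periodicBump : Continuous periodicBump := by
  unfold periodicBump
  exact continuous_unitClamp.comp (by fun_prop)

lemma half_le_cos {u : ℝ} (hu : 0 ≤ u) (hu' : u ≤ 1 / 6) :
    1 / 2 ≤ Real.cos (u * (2 * Real.pi)) := by
  rw [← Real.cos_pi_div_three]
  have := Real.pi_pos
  apply Real.cos_le_cos_of_nonneg_of_le_pi <;> nlinarith

lemma unitClamp_mul_periodicBump (t : ℝ) (k : ℕ) :
    unitClamp (6 * (t - k - 0)) * ((1 - unitClamp (6 * (t - k - 0))) * periodicBump t) = 0 := by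
  rcases le_total (6 * (t - k - 0)) 0 with h | h
  · rw [unitClamp_of_nonpos h, zero_mul]
  rcases le_total 1 (6 * (t - k - 0)) with h' | h'
  · rw [unitClamp_of_one_le h', sub_self, zero_mul, mul_zero]
  have hc := half_le_cos (u := t - k) (by linarith) (by linarith)
  rw [sub_mul, Real.cos_sub_nat_mul_two_pi] at hc
  rw [periodicBump, unitClamp_of_nonpos (sub_nonpos.2 hc), mul_zero, mul_zero]

lemma unitClamp_mul_one_sub_periodicBump (t : ℝ) (k : ℕ) :
    unitClamp (6 * (t - k - 1 / 2)) *
      ((1 - unitClamp (6 * (t - k - 1 / 2))) * (1 - periodicBump t)) = 0 := by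
  rcases le_total (6 * (t - k - 1 / 2)) 0 with h | h
  · rw [unitClamp_of_nonpos h, zero_mul]
  rcases le_total 1 (6 * (t - k - 1 / 2)) with h' | h'
  · rw [unitClamp_of_one_le h', sub_self, zero_mul, mul_zero]
  have hc := half_le_cos (u := t - k - 1 / 2) (by linarith) (by linarith)
  rw [show (t - k - 1 / 2) * (2 * Real.pi) = t * (2 * Real.pi) - k * (2 * Real.pi) - Real.pi by
    ring, Real.cos_sub_pi, Real.cos_sub_nat_mul_two_pi] at hc
  rw [periodicBump, unitClamp_of_one_le (x := 1 / 2 - Real.cos _) (by linarith), sub_self, mul_zero,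
    mul_zero]

section BilinearMaps

variable {B E : Type*} [CStarAlgebra B] [NormedAddCommGroup E] [NormedSpace ℂ E]

lemma bilinear_eq_of_mul_one_sub_mul_eq_zero (V : B →L[ℂ] B →L[ℂ] E)
    (hV : ∀ x y : B, x * y = 0 → y * x = 0 → V x y = 0) {e p : B} (hep : Commute e p)
    (h : e * ((1 - e) * p) = 0) : V e p = V 1 (e * p) := by
  have h₁ : V e ((1 - e) * p) = 0 := hV _ _ h <| by
    rw [mul_assoc, ← hep.eq]
    simpa [mul_sub, sub_mul] using h
  have h₂ : V (1 - e) (e * p) = 0 := by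
    apply hV
    · simpa [mul_sub, sub_mul, mul_assoc] using h
    · rw [mul_assoc, mul_sub, mul_one, ← hep.eq]
      simpa [mul_sub, sub_mul, mul_assoc] using h
  have h₃ : V e p = V e (e * p) := by
    rw [sub_mul, one_mul, map_sub, sub_eq_zero] at h₁
    exact h₁
  rw [map_sub, sub_apply, sub_eq_zero] at h₂
  rw [h₃, h₂]

/-- If `g` is approximated by a staircase whose jumps avoid the support of `w`, then
`V g w` is close to `V 1 (g * w)`. -/
lemma norm_bilinear_sub_le (V : B →L[ℂ] B →L[ℂ] E)
    (hV : ∀ x y : B, x * y = 0 → y * x = 0 → V x y = 0) {g : B} (hg : IsSelfAdjoint g) {N : ℕ}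
    (hN : ∀ t ∈ spectrum ℝ g, 0 ≤ t ∧ t ≤ N) {a : ℝ} (ha : 0 ≤ a) (ha' : a ≤ 1) {w : ℝ → ℝ}
    (hw : Continuous w) (hw₁ : ∀ t, |w t| ≤ 1)
    (haw : ∀ (t : ℝ) (k : ℕ), unitClamp (6 * (t - k - a)) *
      ((1 - unitClamp (6 * (t - k - a))) * w t) = 0) :
    ‖V g (cfc w g) - V 1 (g * cfc w g)‖ ≤ ‖V‖ * (1 + ‖(1 : B)‖) := by
  have hc : ∀ k : ℕ, Continuous fun t : ℝ ↦ unitClamp (6 * (t - k - a)) :=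
    fun k ↦ continuous_unitClamp.comp (by fun_prop)
  set p := cfc w g with hp
  set e : ℕ → B := fun k ↦ cfc (fun t : ℝ ↦ unitClamp (6 * (t - k - a))) g with he
  set q : B := ∑ k ∈ Finset.range N, e k with hq
  have hqV : V q p = V 1 (q * p) := by
    rw [hq, Finset.sum_mul, map_sum, map_sum, sum_apply]
    refine Finset.sum_congr rfl fun k _ ↦ ?_
    refine bilinear_eq_of_mul_one_sub_mul_eq_zero V hV (cfc_commute_cfc _ _ g) ?_
    rw [he, hp, ← cfc_one ℝ g]
    rw [← cfc_sub _ _ g (by fun_prop) (hc k).continuousOn,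
      ← cfc_mul _ _ g (by have := hc k; fun_prop) hw.continuousOn,
      ← cfc_mul _ _ g (hc k).continuousOn (by have := hc k; fun_prop)]
    simp [haw]
  have hgq : ‖g - q‖ ≤ 1 := by
    have : g - q = cfc (fun t : ℝ ↦ t - ∑ k ∈ Finset.range N, unitClamp (6 * (t - k - a))) g := by
      rw [cfc_sub _ _ g (by fun_prop)
        (continuous_finsetSum _ fun k _ ↦ hc k).continuousOn, cfc_id' ℝ g, hq, he,
        ← cfc_sum _ g _ fun k _ ↦ (hc k).continuousOn]
      simp only [Finset.sum_fn]
    rw [this]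
    exact norm_cfc_le zero_le_one fun t ht ↦
      abs_sub_sum_unitClamp_le ha ha' (hN t ht).1 (hN t ht).2
  have hp₁ : ‖p‖ ≤ 1 := norm_cfc_le zero_le_one fun t _ ↦ hw₁ t
  have hsplit : V g p - V 1 (g * p) = V (g - q) p - V 1 ((g - q) * p) := by
    rw [sub_mul, map_sub V, map_sub (V 1), sub_apply, hqV]
    abel
  rw [hsplit]
  have h₁ : ‖V (g - q) p‖ ≤ ‖V‖ := (V.le_opNorm₂ _ _).trans <| by
    have := mul_le_one₀ hgq (norm_nonneg p) hp₁
    nlinarith [norm_nonneg V]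
  have h₂ : ‖V 1 ((g - q) * p)‖ ≤ ‖V‖ * ‖(1 : B)‖ := (V.le_opNorm₂ _ _).trans <| by
    refine mul_le_of_le_one_right (by positivity) ((norm_mul_le _ _).trans ?_)
    exact mul_le_one₀ hgq (norm_nonneg p) hp₁
  linarith [norm_sub_le (V (g - q) p) (V 1 ((g - q) * p))]

/-- A bounded bilinear map vanishing at pairs with zero products satisfies `V h 1 = V 1 h` at
self-adjoint elements. -/
lemma bilinear_apply_one_eq (V : B →L[ℂ] B →L[ℂ] E)
    (hV : ∀ x y : B, x * y = 0 → y * x = 0 → V x y = 0) {h : B} (hh : IsSelfAdjoint h) :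
    V h 1 = V 1 h := by
  have hbound : ∀ (g : B), IsSelfAdjoint g → ∀ N : ℕ,
      (∀ t ∈ spectrum ℝ g, 0 ≤ t ∧ t ≤ N) →
      ‖V g 1 - V 1 g‖ ≤ 2 * (‖V‖ * (1 + ‖(1 : B)‖)) := by
    intro g hg N hN
    have hP₀ : ∀ t, 0 ≤ periodicBump t := fun t ↦ unitClamp_nonneg _
    have hP₁ : ∀ t, periodicBump t ≤ 1 := fun t ↦ unitClamp_le_one _
    have h₁ := norm_bilinear_sub_le V hV hg hN le_rfl zero_le_one continuous_periodicBump
      (fun t ↦ abs_le.2 ⟨by linarith [hP₀ t], hP₁ t⟩) unitClamp_mul_periodicBump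
    have h₂ := norm_bilinear_sub_le V hV hg hN (by norm_num) (by norm_num)
      (w := fun t ↦ 1 - periodicBump t) (continuous_const.sub continuous_periodicBump)
      (fun t ↦ abs_le.2 ⟨by linarith [hP₁ t], by linarith [hP₀ t]⟩)
      unitClamp_mul_one_sub_periodicBump
    have hsum : cfc (fun t ↦ 1 - periodicBump t) g = 1 - cfc periodicBump g := by
      rw [cfc_sub _ _ g (by fun_prop) continuous_periodicBump.continuousOn, cfc_const_one ℝ g]
    rw [hsum] at h₂
    have hsplit : V g 1 - V 1 g = (V g (cfc periodicBump g) - V 1 (g * cfc periodicBump g)) +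
        (V g (1 - cfc periodicBump g) - V 1 (g * (1 - cfc periodicBump g))) := by
      rw [mul_sub, mul_one, map_sub, map_sub]
      abel
    rw [hsplit]
    linarith [norm_add_le (V g (cfc periodicBump g) - V 1 (g * cfc periodicBump g))
        (V g (1 - cfc periodicBump g) - V 1 (g * (1 - cfc periodicBump g)))]
  set C := 2 * (‖V‖ * (1 + ‖(1 : B)‖))
  set R := ‖h‖ * ‖(1 : B)‖
  have hmul : ∀ n : ℕ, n * ‖V h 1 - V 1 h‖ ≤ C := by
    intro n
    obtain ⟨N, hN⟩ := exists_nat_ge ((n : ℝ) * (R + R))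
    have hg : cfc (fun t : ℝ ↦ n * (t + R)) h = (n : ℂ) • (h + (R : ℂ) • (1 : B)) := by
      rw [cfc_const_mul _ _ h, cfc_add_const _ _ h, cfc_id' ℝ h, Algebra.algebraMap_eq_smul_one]
      simp [← Complex.coe_smul]
    have := hbound (cfc (fun t : ℝ ↦ n * (t + R)) h) (cfc_predicate _ h) N <| by
      rw [cfc_map_spectrum (R := ℝ) (fun t : ℝ ↦ n * (t + R)) h]
      rintro _ ⟨t, ht, rfl⟩
      have ht' : |t| ≤ R := spectrum.norm_le_norm_mul_of_mem ht
      rw [abs_le] at ht'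
      have hn : (0 : ℝ) ≤ n := n.cast_nonneg
      exact ⟨mul_nonneg hn (by linarith), (mul_le_mul_of_nonneg_left (by linarith) hn).trans hN⟩
    rw [hg] at this
    have heq : V ((n : ℂ) • (h + (R : ℂ) • (1 : B))) 1 - V 1 ((n : ℂ) • (h + (R : ℂ) • (1 : B))) =
        (n : ℂ) • (V h 1 - V 1 h) := by
      simp only [map_smul, map_add, smul_apply, add_apply,
        smul_add, smul_sub]
      abel
    rw [heq, norm_smul] at this
    simpa using this
  by_contra hne
  have hpos : 0 < ‖V h 1 - V 1 h‖ := norm_pos_iff.2 (sub_ne_zero.2 hne)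
  obtain ⟨n, hn⟩ := exists_nat_gt (C / ‖V h 1 - V 1 h‖)
  rw [div_lt_iff₀ hpos] at hn
  exact absurd (hmul n) (not_le.2 hn)

/-- A bounded bilinear map vanishing at pairs with zero products satisfies `V x 1 = V 1 x`. -/
lemma bilinear_apply_one_eq_one_apply (V : B →L[ℂ] B →L[ℂ] E)
    (hV : ∀ x y : B, x * y = 0 → y * x = 0 → V x y = 0) (x : B) : V x 1 = V 1 x := by
  rw [← realPart_add_I_smul_imaginaryPart x]
  simp [bilinear_apply_one_eq V hV (realPart x).2, bilinear_apply_one_eq V hV (imaginaryPart x).2]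

/-- A bounded linear map with `S a * b = a * S b` whenever `a * b = b * a = 0` is the Jordan
multiplication by `S 1`. -/
lemma apply_eq_jordan_mul (S : B →L[ℂ] B)
    (hS : ∀ a b : B, a * b = 0 → b * a = 0 → S a * b = a * S b) (x : B) :
    S x = (2⁻¹ : ℂ) • (S 1 * x + x * S 1) := by
  set V := (ContinuousLinearMap.mul ℂ B).bilinearComp S (.id ℂ B) -
    (ContinuousLinearMap.mul ℂ B).bilinearComp (.id ℂ B) S with hVdef
  have hV : ∀ a b, V a b = S a * b - a * S b := fun a b ↦ by simp [hVdef]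
  have := bilinear_apply_one_eq_one_apply V
    (fun a b hab hba ↦ by rw [hV, hS a b hab hba, sub_self]) x
  rw [hV, hV, mul_one, one_mul] at this
  have h2 : (2 : ℂ) • S x = S 1 * x + x * S 1 := by
    rw [two_smul, ← sub_eq_zero, ← sub_eq_zero.2 this]
    abel
  rw [← h2, smul_smul]
  norm_num

end BilinearMaps

/-- A central element of square zero vanishes. -/
lemma eq_zero_of_central_of_mul_self_eq_zero {R : Type*} [NonUnitalNormedRing R] [StarRing R]
    [CStarRing R] {p : R} (hp : ∀ c, p * c = c * p)
    (hpp : p * p = 0) : p = 0 := by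
  rw [← CStarRing.star_mul_self_eq_zero_iff, ← CStarRing.star_mul_self_eq_zero_iff]
  rw [star_mul, star_star, mul_assoc, ← mul_assoc p, hp (star p), mul_assoc, hpp]
  simp

lemma map_mul_eq_mul_map_of_tripleDerivableAtOrthPairs (T : A →L[ℂ] A)
    (hanti : ∀ x : A, star (T (star x)) = -T x)
    (hT : TripleDerivableAtOrthPairs (T : A → A)) {a b : A} (hab : a * b = 0) (hba : b * a = 0) :
    T a * b = a * T b := by
  have key : ∀ c, (T a * b - a * T b) * c + c * (b * T a - T b * a) = 0 := by
    intro c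
    have h := hT a (star b) c (by simp [Orthog, hab, hba])
    simp only [tp, hanti, star_star, hab, ← smul_add] at h
    have h' := (smul_eq_zero.1 h).resolve_left (by norm_num)
    rw [mul_assoc (T c), hba] at h'
    rw [← h']
    noncomm_ring
  set p := T a * b - a * T b with hp
  have hq : b * T a - T b * a = -p := by
    have := key 1
    rw [mul_one, one_mul] at this
    exact (neg_eq_of_add_eq_zero_right this).symm
  have hcentral : ∀ c, p * c = c * p := by
    intro c
    have := key c
    rwa [hq, mul_neg, ← sub_eq_add_neg, sub_eq_zero] at this
  have two_torsion : ∀ x : A, x = -x → x = 0 := by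
    intro x hx
    have : (2 : ℂ) • x = 0 := by rw [two_smul]; nth_rw 1 [hx]; simp
    exact (smul_eq_zero.1 this).resolve_left two_ne_zero
  have hpa : p * a = 0 := by
    have h₁ : p * a = -(a * T b * a) := by
      rw [hp, sub_mul, mul_assoc (T a), hba, mul_zero, zero_sub]
    have h₂ : a * p = a * T b * a := by
      rw [← neg_eq_iff_eq_neg.2 hq, mul_neg, mul_sub, ← mul_assoc, hab]
      noncomm_ring
    exact two_torsion _ (h₁.trans (congrArg Neg.neg (h₂.symm.trans (hcentral a).symm)))
  have hpb : p * b = 0 := by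
    have h₁ : p * b = -(b * T a * b) := by
      rw [← neg_eq_iff_eq_neg.2 hq, neg_mul, sub_mul, mul_assoc (T b), hab]
      noncomm_ring
    have h₂ : b * p = b * T a * b := by
      rw [hp, mul_sub, ← mul_assoc b a, hba, zero_mul, sub_zero, mul_assoc]
    exact two_torsion _ (h₁.trans (congrArg Neg.neg (h₂.symm.trans (hcentral b).symm)))
  have hpp : p * p = 0 := by
    nth_rw 2 [hp]
    rw [mul_sub, ← mul_assoc, ← mul_assoc, hpa, hcentral (T a), mul_assoc, hpb, mul_zero,
      zero_mul, sub_zero]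
  exact sub_eq_zero.1 (eq_zero_of_central_of_mul_self_eq_zero hcentral hpp)

/-- an anti-symmetric bounded linear map on a unital C*-algebra which is
triple derivable at orthogonal pairs satisfies: `T 1` is skew-adjoint,
`T x = (1/2)(T 1 * x + x * T 1)`, and `T` is a triple derivation. -/
theorem stmt3 (T : A →L[ℂ] A)
    (hanti : ∀ x : A, star (T (star x)) = -T x)
    (hT : TripleDerivableAtOrthPairs (T : A → A)) :
    star (T 1) = -T 1 ∧
    (∀ x : A, T x = (2⁻¹ : ℂ) • (T 1 * x + x * T 1)) ∧
    IsTripleDerivation (T : A → A) := by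
  have hS : ∀ a b : A, a * b = 0 → b * a = 0 → T a * b = a * T b := fun a b hab hba ↦
    map_mul_eq_mul_map_of_tripleDerivableAtOrthPairs T hanti hT hab hba
  have h1 : star (T 1) = -T 1 := by simpa using hanti 1
  let _ : CStarAlgebra A := {}
  have hform : ∀ x : A, T x = (2⁻¹ : ℂ) • (T 1 * x + x * T 1) := apply_eq_jordan_mul T hS
  refine ⟨h1, hform, fun a b c ↦ ?_⟩
  have hstar : star (T b) = -((2⁻¹ : ℂ) • (T 1 * star b + star b * T 1)) := by
    rw [← hform, ← hanti, star_star]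
  simp only [tp]
  rw [hstar, map_smul, hform (_ + _), hform a, hform c]
  simp only [mul_add, add_mul, mul_neg, neg_mul, smul_mul_assoc, mul_smul_comm, smul_add,
    smul_neg, mul_assoc]
  module
end

section
/- Let A be a unital C*-algebra and let ξ ∈ A be an element such that a·ξ·b + b·ξ·a = 0 for all self-adjoint elements a, b ∈ A with a·b = 0. Then ξ is central in A, i.e. ξx = xξ for all x ∈ A. -/
section CentralOfOrthogonal

variable {B : Type*} [CStarAlgebra B]

/-- If `a ξ b + b ξ a` vanishes on orthogonal self-adjoint pairs, so does `a ξ b`. -/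
theorem mul_mul_eq_zero_of_orthogonal {ξ : B}
    (h : ∀ a b : B, IsSelfAdjoint a → IsSelfAdjoint b → a * b = 0 →
      a * ξ * b + b * ξ * a = 0)
    {a b : B} (ha : IsSelfAdjoint a) (hb : IsSelfAdjoint b) (hab : a * b = 0) :
    a * ξ * b = 0 := by
  have h1 : a * (a * ξ * b) = 0 := by
    have h2 := congrArg (a * ·) (h a b ha hb hab)
    simpa [mul_add, ← mul_assoc, hab] using h2
  rw [← CStarRing.star_mul_self_eq_zero_iff]
  rw [star_mul, star_mul, ha.star_eq, hb.star_eq]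
  calc b * (star ξ * a) * (a * ξ * b) = b * star ξ * (a * (a * ξ * b)) := by noncomm_ring
    _ = 0 := by rw [h1, mul_zero]

theorem cfc_mul_mul_cfc_eq_zero {ξ : B}
    (h : ∀ a b : B, IsSelfAdjoint a → IsSelfAdjoint b → a * b = 0 → a * ξ * b = 0)
    (y : B) {f g : ℝ → ℝ} (hf : Continuous f) (hg : Continuous g) (hfg : ∀ t, f t * g t = 0) :
    cfc f y * ξ * cfc g y = 0 := by
  refine h _ _ (cfc_predicate f y) (cfc_predicate g y) ?_
  rw [← cfc_mul f g y hf.continuousOn hg.continuousOn]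
  simp [hfg]

/-- Locality of `ξ` lets a cutoff `k`, equal to `1` on the support of `a`, be inserted on the
right. -/
theorem norm_cfc_mul_mul_cfc_le {ξ : B}
    (h : ∀ a b : B, IsSelfAdjoint a → IsSelfAdjoint b → a * b = 0 → a * ξ * b = 0)
    (y : B) {a b k : ℝ → ℝ} (ha : Continuous a) (hb : Continuous b) (hk : Continuous k)
    (hak : ∀ t, a t * (1 - k t) = 0) {c d : ℝ} (hc : 0 ≤ c) (hd : 0 ≤ d)
    (hac : ∀ t, |a t| ≤ c) (hbd : ∀ t, |b t * k t| ≤ d) :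
    ‖cfc a y * ξ * cfc b y‖ ≤ c * ‖ξ‖ * d := by
  have hsplit : cfc b y = cfc (fun t => b t * k t) y + cfc (fun t => b t * (1 - k t)) y := by
    rw [← cfc_add y (fun t => b t * k t) (fun t => b t * (1 - k t))
      (by fun_prop) (by fun_prop)]
    congr 1
    ext t
    ring
  have hzero : cfc a y * ξ * cfc (fun t => b t * (1 - k t)) y = 0 :=
    cfc_mul_mul_cfc_eq_zero h y ha (by fun_prop) fun t => by
      rw [mul_left_comm, hak, mul_zero]
  rw [hsplit, mul_add, hzero, add_zero]
  have h1 : ‖cfc a y‖ ≤ c := norm_cfc_le hc fun t _ => hac t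
  have h2 : ‖cfc (fun t => b t * k t) y‖ ≤ d := norm_cfc_le hd fun t _ => hbd t
  calc _ ≤ ‖cfc a y‖ * ‖ξ‖ * ‖cfc (fun t => b t * k t) y‖ := norm_mul₃_le
    _ ≤ c * ‖ξ‖ * d := by gcongr

theorem lie_cfc_sub_const {y : B} (hy : IsSelfAdjoint y) {p : ℝ → ℝ} (hp : Continuous p)
    (α : ℝ) (w : B) : ⁅cfc (fun t => p t - α) y, w⁆ = ⁅cfc p y, w⁆ := by
  rw [cfc_sub p (fun _ => α) y hp.continuousOn, cfc_const α y hy, Ring.lie_def, Ring.lie_def, sub_mul, mul_sub,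
    Algebra.commutes]
  abel

theorem norm_cfc_mul_lie_lie_le {ξ : B}
    (h : ∀ a b : B, IsSelfAdjoint a → IsSelfAdjoint b → a * b = 0 → a * ξ * b = 0)
    {y : B} (hy : IsSelfAdjoint y) {f k p q : ℝ → ℝ} (hf : Continuous f) (hk : Continuous k)
    (hp : Continuous p) (hq : Continuous q) (hfk : ∀ t, f t * (1 - k t) = 0)
    (hf1 : ∀ t, |f t| ≤ 1) (hk1 : ∀ t, |k t| ≤ 1) {ε α β : ℝ} (hε : 0 ≤ ε)
    (hpk : ∀ t, k t ≠ 0 → |p t - α| ≤ ε) (hqk : ∀ t, k t ≠ 0 → |q t - β| ≤ ε) :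
    ‖cfc f y * ⁅cfc p y, ⁅cfc q y, ξ⁆⁆‖ ≤ 4 * ε ^ 2 * ‖ξ‖ := by
  rw [← lie_cfc_sub_const hy hp α, ← lie_cfc_sub_const hy hq β]
  set P : ℝ → ℝ := fun t => p t - α with hP
  set Q : ℝ → ℝ := fun t => q t - β with hQ
  have hPc : Continuous P := by fun_prop
  have hQc : Continuous Q := by fun_prop
  have hf0 : ∀ t, f t ≠ 0 → k t ≠ 0 := fun t ht hkt => by
    have := hfk t
    simp [hkt, ht] at this
  have bound : ∀ {g r : ℝ → ℝ} {M : ℝ}, 0 ≤ M → (∀ t, |g t| ≤ 1) →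
      (∀ t, g t ≠ 0 → |r t| ≤ M) → ∀ t, |g t * r t| ≤ M := by
    intro g r M hM hg hr t
    by_cases h0 : g t = 0
    · simpa [h0] using hM
    · rw [abs_mul]
      nlinarith [hg t, hr t h0, abs_nonneg (g t), abs_nonneg (r t)]
  have hPQ : ∀ t, k t ≠ 0 → |P t * Q t| ≤ ε ^ 2 := fun t ht => by
    rw [abs_mul, pow_two]
    exact mul_le_mul (hpk t ht) (hqk t ht) (abs_nonneg _) hε
  have e1 : cfc (fun t => f t * (P t * Q t)) y = cfc f y * (cfc P y * cfc Q y) := by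
    rw [← cfc_mul P Q y (by fun_prop) (by fun_prop), ← cfc_mul f _ y (by fun_prop) (by fun_prop)]
  have e2 : cfc (fun t => f t * P t) y = cfc f y * cfc P y :=
    cfc_mul f P y (by fun_prop) (by fun_prop)
  have e3 : cfc (fun t => f t * Q t) y = cfc f y * cfc Q y :=
    cfc_mul f Q y (by fun_prop) (by fun_prop)
  have e4 : cfc (fun t => Q t * P t) y = cfc Q y * cfc P y :=
    cfc_mul Q P y (by fun_prop) (by fun_prop)
  have e5 : cfc (fun _ => (1 : ℝ)) y = 1 := cfc_const_one ℝ y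
  have key : cfc f y * ⁅cfc P y, ⁅cfc Q y, ξ⁆⁆ =
      cfc (fun t => f t * (P t * Q t)) y * ξ * cfc (fun _ => (1 : ℝ)) y
      - cfc (fun t => f t * P t) y * ξ * cfc Q y
      - cfc (fun t => f t * Q t) y * ξ * cfc P y
      + cfc f y * ξ * cfc (fun t => Q t * P t) y := by
    rw [e1, e2, e3, e4, e5, Ring.lie_def, Ring.lie_def]
    noncomm_ring
  have hcut : ∀ (r : ℝ → ℝ) (t : ℝ), f t * r t * (1 - k t) = 0 := fun r t => by
    rw [mul_right_comm, hfk, zero_mul]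
  have n1 := norm_cfc_mul_mul_cfc_le h y (a := fun t => f t * (P t * Q t)) (b := fun _ => 1)
    (by fun_prop) (by fun_prop) hk (hcut _) (sq_nonneg ε) zero_le_one
    (bound (sq_nonneg ε) hf1 fun t ht => hPQ t (hf0 t ht)) (by simpa using hk1)
  have n2 := norm_cfc_mul_mul_cfc_le h y (a := fun t => f t * P t) (b := Q)
    (by fun_prop) (by fun_prop) hk (hcut _) hε hε
    (bound hε hf1 fun t ht => hpk t (hf0 t ht))
    (fun t => by rw [mul_comm]; exact bound hε hk1 hqk t)
  have n3 := norm_cfc_mul_mul_cfc_le h y (a := fun t => f t * Q t) (b := P)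
    (by fun_prop) (by fun_prop) hk (hcut _) hε hε
    (bound hε hf1 fun t ht => hqk t (hf0 t ht))
    (fun t => by rw [mul_comm]; exact bound hε hk1 hpk t)
  have n4 := norm_cfc_mul_mul_cfc_le h y (a := f) (b := fun t => Q t * P t)
    hf (by fun_prop) hk hfk zero_le_one (sq_nonneg ε) hf1
    (fun t => by
      rw [mul_comm, mul_comm (Q t)]
      exact bound (sq_nonneg ε) hk1 hPQ t)
  rw [key]
  refine (norm_add_le_of_le (norm_sub_le_of_le (norm_sub_le_of_le n1 n2) n3) n4).trans ?_
  apply le_of_eq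
  ring

/-- Iterated commutators with Lipschitz functions of a self-adjoint element vanish on local
elements: cutting up the spectrum into `m` pieces costs `m` terms of size `O(m⁻²)`. -/
theorem lie_cfc_lie_cfc_eq_zero {ξ : B}
    (h : ∀ a b : B, IsSelfAdjoint a → IsSelfAdjoint b → a * b = 0 → a * ξ * b = 0)
    {y : B} (hy : IsSelfAdjoint y) {p q : ℝ → ℝ} (hp : LipschitzWith 1 p)
    (hq : LipschitzWith 1 q) : ⁅cfc p y, ⁅cfc q y, ξ⁆⁆ = 0 := by
  set R : ℝ := ‖y‖ * ‖(1 : B)‖ + 1 with hR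
  have hR0 : 0 < R := by positivity
  have hspec : ∀ t ∈ spectrum ℝ y, |t| ≤ R := fun t ht => by
    have := spectrum.norm_le_norm_mul_of_mem ht
    rw [Real.norm_eq_abs] at this
    linarith
  have main : ∀ m : ℕ, ‖⁅cfc p y, ⁅cfc q y, ξ⁆⁆‖ ≤
      128 * R ^ 2 * ‖ξ‖ * (1 / ((m : ℝ) + 1)) := by
    intro m
    set M : ℝ := (m : ℝ) + 1 with hM
    have hM0 : 0 < M := by positivity
    have hM1 : 1 ≤ M := by simp [hM]
    set δ : ℝ := 2 * R / M with hδ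
    have hδ0 : 0 < δ := by positivity
    set s : ℝ → ℝ := fun t => (t + R) / δ with hs
    have hsc : Continuous s := by fun_prop
    set g : ℕ → ℝ → ℝ := fun i t => max 0 (min 1 (s t - i + 1)) with hg
    have hgc : ∀ i, Continuous (g i) := fun i => by fun_prop
    set f : ℕ → ℝ → ℝ := fun i t => g i t - g (i + 1) t with hf
    have hfc : ∀ i, Continuous (f i) := fun i => by fun_prop
    set k : ℕ → ℝ → ℝ := fun i t => max 0 (min 1 (2 - |s t - i|)) with hk
    have hkc : ∀ i, Continuous (k i) := fun i => by fun_prop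
    have hsum : ∑ i ∈ Finset.range (m + 2), cfc (f i) y = 1 := by
      have hdiff : ∀ i, cfc (f i) y = cfc (g i) y - cfc (g (i + 1)) y := fun i =>
        cfc_sub (g i) (g (i + 1)) y (hgc i).continuousOn (hgc (i + 1)).continuousOn
      have hs0 : ∀ t ∈ spectrum ℝ y, 0 ≤ s t ∧ s t ≤ M := by
        intro t ht
        have h1 := abs_le.mp (hspec t ht)
        refine ⟨div_nonneg (by linarith) hδ0.le, ?_⟩
        rw [hs, div_le_iff₀ hδ0, hδ, mul_div_cancel₀ _ hM0.ne']
        linarith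
      have hfirst : cfc (g 0) y = 1 := by
        rw [← cfc_const_one ℝ y]
        refine cfc_congr fun t ht => ?_
        have := hs0 t ht
        simp only [hg, Nat.cast_zero]
        rw [min_eq_left (by linarith), max_eq_right zero_le_one]
      have hlast : cfc (g (m + 2)) y = 0 := by
        rw [← cfc_const_zero ℝ y]
        refine cfc_congr fun t ht => ?_
        have := hs0 t ht
        simp only [hg]
        push_cast
        exact max_eq_left ((min_le_right _ _).trans (by linarith))
      simp_rw [hdiff]
      rw [Finset.sum_range_sub', hfirst, hlast, sub_zero]
    have hterm : ∀ i : ℕ, ‖cfc (f i) y * ⁅cfc p y, ⁅cfc q y, ξ⁆⁆‖ ≤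
        4 * (2 * δ) ^ 2 * ‖ξ‖ := by
      intro i
      have hlip : ∀ {r : ℝ → ℝ}, LipschitzWith 1 r → ∀ t, k i t ≠ 0 →
          |r t - r (i * δ - R)| ≤ 2 * δ := by
        intro r hr t ht
        have h1 := hr.dist_le_mul t (i * δ - R)
        simp only [Real.dist_eq, NNReal.coe_one, one_mul] at h1
        refine h1.trans ?_
        have h2 : |s t - i| ≤ 2 := by
          by_contra! hlt
          exact ht (max_eq_left ((min_le_right _ _).trans (by linarith)))
        have h3 : t - (i * δ - R) = (s t - i) * δ := by
          simp only [hs]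
          field_simp
          ring
        rw [h3, abs_mul, abs_of_pos hδ0]
        gcongr
      refine norm_cfc_mul_lie_lie_le h hy (hfc i) (hkc i) hp.continuous hq.continuous
        ?_ ?_ ?_ (by positivity) (hlip hp) (hlip hq)
      · intro t
        simp only [hf, hg, hk, Nat.cast_add, Nat.cast_one]
        rcases le_total |s t - i| 1 with h1 | h1
        · have hk' : min 1 (2 - |s t - i|) = 1 := min_eq_left (by linarith)
          rw [hk', max_eq_right zero_le_one, sub_self, mul_zero]
        · rcases le_abs.mp h1 with h2 | h2
          · rw [min_eq_left (by linarith), min_eq_left (by linarith), sub_self, zero_mul]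
          · rw [min_eq_right (by linarith), min_eq_right (by linarith),
              max_eq_left (by linarith), max_eq_left (by linarith), sub_self, zero_mul]
      · intro t
        have hb : ∀ j, 0 ≤ g j t ∧ g j t ≤ 1 := fun j =>
          ⟨le_max_left _ _, max_le zero_le_one (min_le_left _ _)⟩
        rw [abs_le]
        constructor <;> simp only [hf] <;> linarith [(hb i).1, (hb i).2,
          (hb (i + 1)).1, (hb (i + 1)).2]
      · intro t
        rw [abs_of_nonneg (le_max_left _ _)]
        exact max_le zero_le_one (min_le_left _ _)
    calc ‖⁅cfc p y, ⁅cfc q y, ξ⁆⁆‖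
        = ‖∑ i ∈ Finset.range (m + 2), cfc (f i) y * ⁅cfc p y, ⁅cfc q y, ξ⁆⁆‖ := by
          rw [← Finset.sum_mul, hsum, one_mul]
      _ ≤ ∑ i ∈ Finset.range (m + 2), 4 * (2 * δ) ^ 2 * ‖ξ‖ :=
          norm_sum_le_of_le _ fun i _ => hterm i
      _ = (M + 1) * (64 * R ^ 2 * ‖ξ‖ / M ^ 2) := by
          rw [Finset.sum_const, Finset.card_range, nsmul_eq_mul, hδ]
          push_cast
          rw [hM]
          field_simp
          ring
      _ ≤ (2 * M) * (64 * R ^ 2 * ‖ξ‖ / M ^ 2) := by gcongr; linarith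
      _ = _ := by field_simp; ring
  have hlim := (tendsto_one_div_add_atTop_nhds_zero_nat (𝕜 := ℝ)).const_mul
    (128 * R ^ 2 * ‖ξ‖)
  rw [mul_zero] at hlim
  exact norm_le_zero_iff.mp (ge_of_tendsto' hlim main)

/-- A unitary which commutes with its commutator with `ξ` commutes with `ξ`. -/
theorem lie_eq_zero_of_mem_unitary_of_lie_lie_eq_zero {u ξ : B} (hu : u ∈ unitary B)
    (huu : ⁅u, ⁅u, ξ⁆⁆ = 0) : ⁅u, ξ⁆ = 0 := by
  nontriviality B
  set E := ⁅u, ξ⁆ with hE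
  have hcomm : E * u = u * E := by
    rw [Ring.lie_def, sub_eq_zero] at huu
    exact huu.symm
  have huE : u * ξ = ξ * u + E := by rw [hE, Ring.lie_def]; abel
  have hpow : ∀ n : ℕ, u ^ (n + 1) * ξ - ξ * u ^ (n + 1) = (n + 1 : ℕ) • (u ^ n * E) := by
    intro n
    induction n with
    | zero => simp [huE]
    | succ n ih =>
      have h1 : u ^ (n + 1 + 1) * ξ - ξ * u ^ (n + 1 + 1) =
          u ^ (n + 1) * E + (u ^ (n + 1) * ξ - ξ * u ^ (n + 1)) * u := by
        rw [pow_succ u (n + 1), mul_assoc _ u ξ, huE]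
        noncomm_ring
      rw [h1, ih, smul_mul_assoc, mul_assoc, hcomm, ← mul_assoc, ← pow_succ,
        succ_nsmul' _ (n + 1)]
  have hbound : ∀ n : ℕ, ‖E‖ ≤ 2 * ‖ξ‖ * (1 / ((n : ℝ) + 1)) := by
    intro n
    have hn : ∀ j, u ^ j ∈ unitary B := fun j => pow_mem hu j
    have h1 : ‖(n + 1 : ℕ) • (u ^ n * E)‖ = ((n : ℝ) + 1) * ‖E‖ := by
      rw [← Nat.cast_smul_eq_nsmul ℝ, norm_smul, CStarRing.norm_mem_unitary_mul _ (hn n)]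
      simp only [Nat.cast_add, Nat.cast_one, Real.norm_eq_abs]
      rw [abs_of_nonneg (by positivity)]
    have h2 : ((n : ℝ) + 1) * ‖E‖ ≤ 2 * ‖ξ‖ := by
      rw [← h1, ← hpow]
      refine (norm_sub_le _ _).trans ?_
      rw [CStarRing.norm_mem_unitary_mul _ (hn _), CStarRing.norm_mul_mem_unitary _ (hn _)]
      linarith
    rw [mul_one_div, le_div_iff₀ (by positivity)]
    linarith
  have hlim := (tendsto_one_div_add_atTop_nhds_zero_nat (𝕜 := ℝ)).const_mul (2 * ‖ξ‖)
  rw [mul_zero] at hlim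
  exact norm_le_zero_iff.mp (ge_of_tendsto' hlim hbound)

theorem lie_cfc_sin_eq_zero {ξ : B}
    (h : ∀ a b : B, IsSelfAdjoint a → IsSelfAdjoint b → a * b = 0 → a * ξ * b = 0)
    {y : B} (hy : IsSelfAdjoint y) : ⁅cfc Real.sin y, ξ⁆ = 0 := by
  have hsin := Real.continuous_sin.continuousOn (s := spectrum ℝ y)
  have hcos := Real.continuous_cos.continuousOn (s := spectrum ℝ y)
  set c := cfc Real.cos y with hc
  set s := cfc Real.sin y with hs
  have hcc := lie_cfc_lie_cfc_eq_zero h hy Real.lipschitzWith_cos Real.lipschitzWith_cos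
  have hcs := lie_cfc_lie_cfc_eq_zero h hy Real.lipschitzWith_cos Real.lipschitzWith_sin
  have hsc := lie_cfc_lie_cfc_eq_zero h hy Real.lipschitzWith_sin Real.lipschitzWith_cos
  have hss := lie_cfc_lie_cfc_eq_zero h hy Real.lipschitzWith_sin Real.lipschitzWith_sin
  rw [← hc] at hcc hcs hsc
  rw [← hs] at hcs hsc hss
  have hsq : c * c + s * s = 1 := by
    rw [hc, hs, ← cfc_mul _ _ y hcos hcos, ← cfc_mul _ _ y hsin hsin,
      ← cfc_add y (fun t => Real.cos t * Real.cos t) (fun t => Real.sin t * Real.sin t)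
        (hcos.mul hcos) (hsin.mul hsin), ← cfc_const_one ℝ y]
    congr 1
    ext t
    nlinarith [Real.sin_sq_add_cos_sq t]
  have hcomm : s * c = c * s := (cfc_commute_cfc Real.sin Real.cos y).eq
  have hstarc : star c = c := (cfc_predicate Real.cos y : IsSelfAdjoint c).star_eq
  have hstars : star s = s := (cfc_predicate Real.sin y : IsSelfAdjoint s).star_eq
  have hunit : ∀ z : ℂ, z * z = -1 → star z = -z → c + z • s ∈ unitary B := by
    intro z hz hz'
    rw [Unitary.mem_iff, star_add, star_smul, hstarc, hstars, hz']
    constructor <;>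
    · simp only [add_mul, mul_add, smul_mul_assoc, mul_smul_comm, smul_add, smul_smul, hcomm, hz,
        neg_smul, neg_mul, mul_neg, one_smul, smul_neg, neg_neg, ← hsq]
      abel
  have hlie : ∀ z : ℂ, z * z = -1 → star z = -z → ⁅c, ξ⁆ + z • ⁅s, ξ⁆ = 0 := by
    intro z hz hz'
    have hadd : ∀ w : B, ⁅c + z • s, w⁆ = ⁅c, w⁆ + z • ⁅s, w⁆ := fun w => by
      simp only [Ring.lie_def, add_mul, mul_add, smul_mul_assoc, mul_smul_comm]
      module
    have hadd' : ∀ v w : B, ⁅v, ⁅c, w⁆ + z • ⁅s, w⁆⁆ = ⁅v, ⁅c, w⁆⁆ + z • ⁅v, ⁅s, w⁆⁆ :=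
        fun v w => by
      rw [Ring.lie_def v, Ring.lie_def v, Ring.lie_def v, add_mul, mul_add, smul_mul_assoc,
        mul_smul_comm]
      module
    rw [← hadd]
    refine lie_eq_zero_of_mem_unitary_of_lie_lie_eq_zero (hunit z hz hz') ?_
    rw [hadd, hadd, hadd', hadd', hcc, hcs, hsc, hss]
    simp
  have h1 := hlie Complex.I Complex.I_mul_I (by simp)
  have h2 := hlie (-Complex.I) (by simp) (by simp)
  have h3 : (2 * Complex.I) • ⁅s, ξ⁆ = 0 := by
    have h4 : (2 * Complex.I) • ⁅s, ξ⁆ =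
        (⁅c, ξ⁆ + Complex.I • ⁅s, ξ⁆) - (⁅c, ξ⁆ + (-Complex.I) • ⁅s, ξ⁆) := by module
    rw [h4, h1, h2, sub_zero]
  exact (smul_eq_zero.mp h3).resolve_left (by simp)

theorem commute_of_isSelfAdjoint_of_orthogonal {ξ : B}
    (h : ∀ a b : B, IsSelfAdjoint a → IsSelfAdjoint b → a * b = 0 → a * ξ * b = 0)
    {x : B} (hx : IsSelfAdjoint x) : Commute ξ x := by
  set R : ℝ := ‖x‖ * ‖(1 : B)‖ + 1 with hR
  have hR0 : 0 < R := by positivity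
  have hspec : ∀ t ∈ spectrum ℝ x, |t| ≤ R := fun t ht => by
    have := spectrum.norm_le_norm_mul_of_mem ht
    rw [Real.norm_eq_abs] at this
    linarith
  have hsin : cfc Real.sin (cfc (fun t => Real.arcsin (R⁻¹ * t)) x) = R⁻¹ • x := by
    rw [← cfc_comp' Real.sin (fun t => Real.arcsin (R⁻¹ * t)) x
      Real.continuous_sin.continuousOn (Real.continuous_arcsin.comp (by fun_prop)).continuousOn,
      ← cfc_const_mul_id R⁻¹ x]
    refine cfc_congr fun t ht => ?_
    have h1 : |R⁻¹ * t| ≤ 1 := by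
      rw [abs_mul, abs_of_pos (inv_pos.mpr hR0), inv_mul_le_iff₀ hR0, mul_one]
      exact hspec t ht
    exact Real.sin_arcsin (abs_le.mp h1).1 (abs_le.mp h1).2
  have h0 := lie_cfc_sin_eq_zero h
    (cfc_predicate (fun t => Real.arcsin (R⁻¹ * t)) x : IsSelfAdjoint _)
  rw [hsin, Ring.lie_def, sub_eq_zero, smul_mul_assoc, mul_smul_comm] at h0
  exact (smul_right_injective B (inv_ne_zero hR0.ne') h0).symm

theorem commute_of_orthogonal {ξ : B}
    (h : ∀ a b : B, IsSelfAdjoint a → IsSelfAdjoint b → a * b = 0 →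
      a * ξ * b + b * ξ * a = 0) (x : B) : Commute ξ x := by
  have h' : ∀ a b : B, IsSelfAdjoint a → IsSelfAdjoint b → a * b = 0 → a * ξ * b = 0 :=
    fun a b ha hb hab => mul_mul_eq_zero_of_orthogonal h ha hb hab
  rw [← realPart_add_I_smul_imaginaryPart x]
  exact (commute_of_isSelfAdjoint_of_orthogonal h' (realPart x).2).add_right
    ((commute_of_isSelfAdjoint_of_orthogonal h' (imaginaryPart x).2).smul_right _)

end CentralOfOrthogonal

variable {A : Type*} [NormedRing A] [StarRing A] [CStarRing A]
  [NormedAlgebra ℂ A] [StarModule ℂ A] [CompleteSpace A]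

/-- if `ξ` in a unital C*-algebra satisfies `a ξ b + b ξ a = 0` for all
orthogonal self-adjoint `a, b`, then `ξ` is central. -/
theorem stmt7 (ξ : A)
    (h : ∀ a b : A, IsSelfAdjoint a → IsSelfAdjoint b → a * b = 0 →
      a * ξ * b + b * ξ * a = 0) :
    ∀ x : A, ξ * x = x * ξ := by
  let _ : CStarAlgebra A := {}
  exact fun x => (commute_of_orthogonal h x).eq
end
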